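/- arXiv:2307.03446 — 5 statements merged into one kernel-verified Lean document; each statement's English description precedes it below -/
import Mathlib

section
/- For every geometric simplicial complex K in a Euclidean space (Fin n → ℝ) over ℝ with finitely many faces, there exist a natural number d and a set V ⊆ (Fin d → Bool) such that the induced cubical complex N(V) (with the subspace topology of Fin d → ℝ) is homeomorphic to the underlying space |K| of K (with the subspace topology). -/
/-- The induced cubical complex of a set `X` of Boolean vertices of the unit cube:
all points `p` of the cube `[0,1]^V` such that every vertex of the minimal face
containing `p` lies in `X`. -/
def inducedCubicalComplex {V : Type*} (X : Set (V → Bool)) : Set (V → ℝ) :=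
  {p | (∀ i, 0 ≤ p i ∧ p i ≤ 1) ∧
    ∀ v : V → Bool, (∀ i, (p i = 0 → v i = false) ∧ (p i = 1 → v i = true)) → v ∈ X}

open Finset in
theorem sum_smul_mem_convexHull_of_support {ι E : Type*} [Fintype ι] [AddCommGroup E]
    [Module ℝ E] {u : ι → E} {s : Set E} {w : ι → ℝ} (hw0 : ∀ i, 0 ≤ w i) (hw1 : ∑ i, w i = 1)
    (hw : ∀ i, w i ≠ 0 → u i ∈ s) : ∑ i, w i • u i ∈ convexHull ℝ s := by
  rw [← sum_filter_of_ne (p := fun i => w i ≠ 0) fun i _ hi => left_ne_zero_of_smul hi]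
  refine (convex_convexHull ℝ s).sum_mem (fun i _ => hw0 i) ?_
    fun i hi => subset_convexHull ℝ s (hw i (mem_filter.1 hi).2)
  rwa [sum_filter_of_ne fun i _ hi => hi]

open Finset in
/-- The weights of an affine combination of the vertices of a face are unique. -/
theorem Geometry.SimplicialComplex.weights_unique {ι E : Type*} [Fintype ι] [AddCommGroup E]
    [Module ℝ E] (K : Geometry.SimplicialComplex ℝ E) {u : ι → E} (hu : Function.Injective u)
    {s : Finset E} (hs : s ∈ K.faces) {f g : ι → ℝ}
    (hf : ∀ i, f i ≠ 0 → u i ∈ s) (hg : ∀ i, g i ≠ 0 → u i ∈ s)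
    (hsum : ∑ i, f i = ∑ i, g i) (hcomb : ∑ i, f i • u i = ∑ i, g i • u i) : f = g := by
  classical
  have hind : AffineIndependent ℝ (fun i : {i // u i ∈ s} => u i) :=
    (K.indep hs).comp_embedding
      ⟨fun i : {i // u i ∈ s} => (⟨u i, i.2⟩ : s), fun i j h => by
        exact Subtype.ext (hu (congrArg Subtype.val h))⟩
  rw [affineIndependent_iff] at hind
  have hz : ∀ i, u i ∉ s → f i - g i = 0 := fun i hi => by
    rw [not_imp_comm.1 (hf i) hi, not_imp_comm.1 (hg i) hi, sub_zero]
  have h := hind (univ.subtype fun i => u i ∈ s) (fun i => f i - g i)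
    (by
      rw [sum_subtype_eq_sum_filter (f := fun i => f i - g i),
        sum_filter_of_ne fun i _ => not_imp_comm.1 (hz i), sum_sub_distrib, hsum, sub_self])
    (by
      rw [sum_subtype_eq_sum_filter (f := fun i => (f i - g i) • u i), sum_filter_of_ne]
      · simp [sub_smul, sum_sub_distrib, hcomb]
      · exact fun i _ => not_imp_comm.1 fun hi => by rw [hz i hi, zero_smul])
  funext i
  by_cases hi : u i ∈ s
  · exact sub_eq_zero.1 (h ⟨i, hi⟩ (by simp))
  · exact sub_eq_zero.1 (hz i hi)

open Finset in
/-- Points of a face are convex combinations of its vertices, for any enumeration of the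
vertices of the complex. -/
theorem Geometry.SimplicialComplex.exists_weights {ι E : Type*} [Fintype ι] [AddCommGroup E]
    [Module ℝ E] (K : Geometry.SimplicialComplex ℝ E) {u : ι → E} (hu : Function.Injective u)
    (hr : Set.range u = K.vertices) {s : Finset E} (hs : s ∈ K.faces) {x : E}
    (hx : x ∈ convexHull ℝ (s : Set E)) :
    ∃ w : ι → ℝ, (∀ i, 0 ≤ w i) ∧ ∑ i, w i = 1 ∧ ∑ i, w i • u i = x ∧
      ∀ i, w i ≠ 0 → u i ∈ s := by
  classical
  obtain ⟨z, hz0, hz1, hzx⟩ := Finset.mem_convexHull'.1 hx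
  have himg : (univ.filter fun i => u i ∈ s).image u = s := by
    ext y
    simp only [mem_image, mem_filter, mem_univ, true_and]
    refine ⟨by rintro ⟨i, hi, rfl⟩; exact hi, fun hy => ?_⟩
    have : y ∈ Set.range u := by
      rw [hr]
      exact K.down_closed hs (singleton_subset_iff.2 hy) (singleton_nonempty y)
    obtain ⟨i, rfl⟩ := this
    exact ⟨i, hy, rfl⟩
  refine ⟨fun i => if u i ∈ s then z (u i) else 0, fun i => ?_, ?_, ?_, fun i hi => ?_⟩
  · dsimp only
    split_ifs with h
    exacts [hz0 _ h, le_rfl]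
  · rw [← sum_filter, ← hz1]
    conv_rhs => rw [← himg]
    rw [sum_image hu.injOn]
  · simp only [ite_smul, zero_smul]
    rw [← sum_filter, ← hzx]
    conv_rhs => rw [← himg]
    rw [sum_image hu.injOn]
  · by_contra h
    simp [h] at hi

open Finset in
/-- Barycentric coordinates in a geometric simplicial complex are unique. -/
theorem Geometry.SimplicialComplex.barycentric_unique {ι E : Type*} [Fintype ι] [AddCommGroup E]
    [Module ℝ E] (K : Geometry.SimplicialComplex ℝ E) {u : ι → E} (hu : Function.Injective u)
    (hr : Set.range u = K.vertices) {s t : Finset E} (hs : s ∈ K.faces) (ht : t ∈ K.faces)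
    {f g : ι → ℝ} (hf0 : ∀ i, 0 ≤ f i) (hg0 : ∀ i, 0 ≤ g i)
    (hf : ∀ i, f i ≠ 0 → u i ∈ s) (hg : ∀ i, g i ≠ 0 → u i ∈ t)
    (hf1 : ∑ i, f i = 1) (hg1 : ∑ i, g i = 1)
    (hcomb : ∑ i, f i • u i = ∑ i, g i • u i) : f = g := by
  classical
  have hxst : ∑ i, f i • u i ∈ convexHull ℝ ((s ∩ t : Finset E) : Set E) := by
    rw [coe_inter]
    exact K.inter_subset_convexHull hs ht ⟨sum_smul_mem_convexHull_of_support hf0 hf1 hf,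
      hcomb ▸ sum_smul_mem_convexHull_of_support hg0 hg1 hg⟩
  have hst : s ∩ t ∈ K.faces := K.down_closed hs inter_subset_left <| by
    rw [← coe_nonempty]
    exact convexHull_nonempty_iff.1 ⟨_, hxst⟩
  obtain ⟨w, -, hw1, hwx, hw⟩ := K.exists_weights hu hr hst hxst
  have h₁ : f = w := K.weights_unique hu hs hf
    (fun i hi => (mem_inter.1 (hw i hi)).1) (hf1.trans hw1.symm) hwx.symm
  have h₂ : g = w := K.weights_unique hu ht hg
    (fun i hi => (mem_inter.1 (hw i hi)).2) (hg1.trans hw1.symm) (hcomb.symm.trans hwx.symm)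
  exact h₁.trans h₂.symm

theorem isCompact_inducedCubicalComplex {ι : Type*} [Finite ι] (X : Set (ι → Bool)) :
    IsCompact (inducedCubicalComplex X) := by
  have hcube : IsCompact (Set.univ.pi fun _ : ι => Set.Icc (0 : ℝ) 1) :=
    isCompact_univ_pi fun _ => isCompact_Icc
  have hclosed : IsClosed {p : ι → ℝ | ∀ v : ι → Bool,
      (∀ i, (p i = 0 → v i = false) ∧ (p i = 1 → v i = true)) → v ∈ X} := by
    simp only [Set.ofPred_forall]
    refine isClosed_iInter fun v => ?_
    by_cases hv : v ∈ X
    · simp [hv]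
    · simp only [hv, imp_false, ← Set.compl_ofPred, isClosed_compl_iff, Set.ofPred_forall]
      refine isOpen_iInter_of_finite fun i => ?_
      cases v i
      · simpa using isOpen_ne_fun (continuous_apply i) continuous_const
      · simpa using isOpen_ne_fun (continuous_apply i) continuous_const
  convert hcube.inter_right hclosed using 1
  ext p
  simp [inducedCubicalComplex, Pi.le_def, forall_and]

/-- The Boolean vectors whose supports are the faces of a simplicial complex, with respect to
an enumeration `u` of points. -/
def Geometry.SimplicialComplex.faceIndicators {ι E : Type*} [AddCommGroup E]
    [Module ℝ E] (K : Geometry.SimplicialComplex ℝ E) (u : ι → E) : Set (ι → Bool) :=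
  {b | ∃ s ∈ K.faces, (s : Set E) = u '' {i | b i = true}}

theorem Geometry.SimplicialComplex.mem_inducedCubicalComplex_faceIndicators {ι E : Type*}
    [AddCommGroup E] [Module ℝ E] (K : Geometry.SimplicialComplex ℝ E) (u : ι → E) (p : ι → ℝ) :
    p ∈ inducedCubicalComplex (K.faceIndicators u) ↔
      (∀ i, 0 ≤ p i ∧ p i ≤ 1) ∧ (∃ i, p i = 1) ∧
        ∃ s ∈ K.faces, (s : Set E) = u '' {i | p i ≠ 0} := by
  classical
  refine and_congr_right fun _ => ⟨fun h => ⟨?_, ?_⟩, ?_⟩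
  · obtain ⟨s, hs, he⟩ := h (fun i => decide (p i = 1)) fun i => by
      constructor <;> intro h <;> simp [h]
    obtain ⟨y, hy⟩ := K.nonempty_of_mem_faces hs
    rw [← Finset.mem_coe, he] at hy
    obtain ⟨i, hi, -⟩ := hy
    exact ⟨i, by simpa using hi⟩
  · obtain ⟨s, hs, he⟩ := h (fun i => decide (p i ≠ 0)) fun i => by
      constructor <;> intro h <;> simp [h]
    exact ⟨s, hs, by simpa using he⟩
  · rintro ⟨⟨i, hi⟩, s, hs, he⟩ v hv
    have hsub : u '' {i | v i = true} ⊆ s := by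
      rw [he]
      refine Set.image_mono fun j hj h0 => ?_
      simp [(hv j).1 h0] at hj
    refine ⟨s.filter (· ∈ u '' {i | v i = true}), K.down_closed hs (Finset.filter_subset _ _)
      ⟨u i, ?_⟩, ?_⟩
    · have : u i ∈ u '' {i | v i = true} := ⟨i, (hv i).2 hi, rfl⟩
      exact Finset.mem_filter.2 ⟨hsub this, this⟩
    · ext y
      simpa using fun j hj hy => hsub ⟨j, hj, hy⟩

open Finset in
/-- The cubical subdivision of a finite simplicial complex is an induced cubical complex: the
central projection onto the simplex is a homeomorphism onto the underlying space. -/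
theorem Geometry.SimplicialComplex.nonempty_homeomorph_inducedCubicalComplex {ι E : Type*}
    [Fintype ι] [AddCommGroup E] [Module ℝ E] [TopologicalSpace E] [IsTopologicalAddGroup E]
    [ContinuousSMul ℝ E] [T2Space E]
    (K : Geometry.SimplicialComplex ℝ E) {u : ι → E} (hu : Function.Injective u)
    (hr : Set.range u = K.vertices) :
    Nonempty (inducedCubicalComplex (K.faceIndicators u) ≃ₜ K.space) := by
  classical
  set N := inducedCubicalComplex (K.faceIndicators u)
  have hN := K.mem_inducedCubicalComplex_faceIndicators u
  have hpos : ∀ p ∈ N, 0 < ∑ i, p i := fun p hp => by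
    obtain ⟨h01, ⟨i, hi⟩, -⟩ := (hN p).1 hp
    exact sum_pos' (fun j _ => (h01 j).1) ⟨i, mem_univ i, by simp [hi]⟩
  have hmem : ∀ p ∈ N, (∑ i, p i)⁻¹ • ∑ i, p i • u i ∈ K.space := fun p hp => by
    obtain ⟨h01, -, s, hs, he⟩ := (hN p).1 hp
    refine K.convexHull_subset_space hs ?_
    rw [smul_sum]
    simp only [smul_smul]
    refine sum_smul_mem_convexHull_of_support
      (fun i => mul_nonneg (inv_nonneg.2 (hpos p hp).le) (h01 i).1)
      (by rw [← mul_sum, inv_mul_cancel₀ (hpos p hp).ne']) fun i hi => ?_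
    rw [he]
    exact ⟨i, right_ne_zero_of_mul hi, rfl⟩
  let φ : N → K.space := fun p => ⟨_, hmem p p.2⟩
  have hφ : Continuous φ := by
    refine Continuous.subtype_mk (Continuous.smul (Continuous.inv₀ ?_ ?_) ?_) _
    · fun_prop
    · exact fun p => (hpos p p.2).ne'
    · exact continuous_finsetSum _ fun i _ =>
        ((continuous_apply i).comp continuous_subtype_val).smul continuous_const
  have hbij : Function.Bijective φ := by
    constructor
    · rintro ⟨p, hp⟩ ⟨q, hq⟩ hpq
      have hpq' : (∑ i, p i)⁻¹ • ∑ i, p i • u i = (∑ i, q i)⁻¹ • ∑ i, q i • u i :=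
        congrArg Subtype.val hpq
      obtain ⟨hp01, ⟨a, ha⟩, s, hs, hse⟩ := (hN p).1 hp
      obtain ⟨hq01, ⟨b, hb⟩, t, ht, hte⟩ := (hN q).1 hq
      have hp' := hpos p hp
      have hq' := hpos q hq
      have hfg := K.barycentric_unique hu hr hs ht (f := fun i => (∑ i, p i)⁻¹ * p i)
        (g := fun i => (∑ i, q i)⁻¹ * q i)
        (fun i => mul_nonneg (inv_nonneg.2 hp'.le) (hp01 i).1)
        (fun i => mul_nonneg (inv_nonneg.2 hq'.le) (hq01 i).1)
        (fun i hi => by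
          rw [← mem_coe, hse]
          exact ⟨i, right_ne_zero_of_mul hi, rfl⟩)
        (fun i hi => by
          rw [← mem_coe, hte]
          exact ⟨i, right_ne_zero_of_mul hi, rfl⟩)
        (by rw [← mul_sum, inv_mul_cancel₀ hp'.ne'])
        (by rw [← mul_sum, inv_mul_cancel₀ hq'.ne'])
        (by simpa only [smul_sum, mul_smul] using hpq')
      have hcoord : ∀ i, (∑ i, p i)⁻¹ * p i = (∑ i, q i)⁻¹ * q i := congrFun hfg
      have hA := hcoord a
      have hB := hcoord b
      rw [ha, mul_one] at hA
      rw [hb, mul_one] at hB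
      have hinv : (∑ i, p i)⁻¹ = (∑ i, q i)⁻¹ := by
        apply le_antisymm
        · rw [hA]
          exact mul_le_of_le_one_right (inv_nonneg.2 hq'.le) (hq01 a).2
        · rw [← hB]
          exact mul_le_of_le_one_right (inv_nonneg.2 hp'.le) (hp01 b).2
      refine Subtype.ext (funext fun i => ?_)
      have := hcoord i
      rw [hinv] at this
      exact mul_left_cancel₀ (inv_ne_zero hq'.ne') this
    · rintro ⟨x, hx⟩
      obtain ⟨s, hs, hxs⟩ := K.mem_space_iff.1 hx
      obtain ⟨w, hw0, hw1, hwx, hw⟩ := K.exists_weights hu hr hs hxs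
      have hne : (univ : Finset ι).Nonempty := by
        rw [nonempty_iff_ne_empty]
        intro h
        simp [h] at hw1
      obtain ⟨m, -, hm⟩ := exists_max_image univ w hne
      have hmpos : 0 < w m := by
        by_contra! h
        have : ∑ i, w i ≤ 0 := sum_nonpos fun i hi => (hm i hi).trans h
        linarith
      have hp : (fun i => w i / w m) ∈ N := by
        refine (hN _).2 ⟨fun i => ⟨div_nonneg (hw0 i) hmpos.le,
          (div_le_one hmpos).2 (hm i (mem_univ i))⟩, ⟨m, div_self hmpos.ne'⟩,
          (univ.filter fun i => w i ≠ 0).image u, K.down_closed hs ?_ ?_, ?_⟩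
        · exact image_subset_iff.2 fun i hi => hw i (mem_filter.1 hi).2
        · exact ⟨u m, mem_image_of_mem u (mem_filter.2 ⟨mem_univ m, hmpos.ne'⟩)⟩
        · simp [hmpos.ne']
      refine ⟨⟨_, hp⟩, Subtype.ext ?_⟩
      change (∑ i, w i / w m)⁻¹ • ∑ i, (w i / w m) • u i = x
      rw [← sum_div, hw1, ← hwx, smul_sum]
      refine sum_congr rfl fun i _ => ?_
      rw [smul_smul]
      congr 1
      field_simp
  have : CompactSpace N :=
    isCompact_iff_compactSpace.1 (isCompact_inducedCubicalComplex (K.faceIndicators u))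
  exact ⟨hφ.homeoOfEquivCompactToT2 (f := Equiv.ofBijective φ hbij)⟩

/-- Every finite geometric simplicial complex is homeomorphic to the induced cubical
complex of some set of vertices of a hypercube. -/
theorem finite_simplicial_complex_homeomorphic_induced_cubical_complex
    (n : ℕ) (K : Geometry.SimplicialComplex ℝ (Fin n → ℝ)) (hK : K.faces.Finite) :
    ∃ (d : ℕ) (V : Set (Fin d → Bool)),
      Nonempty ((inducedCubicalComplex V) ≃ₜ K.space) := by
  have hfin : K.vertices.Finite := hK.preimage (Finset.singleton_injective.injOn)
  have : Finite K.vertices := hfin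
  obtain ⟨d, ⟨e⟩⟩ := Finite.exists_equiv_fin K.vertices
  refine ⟨d, _, K.nonempty_homeomorph_inducedCubicalComplex
    (u := fun i => (e.symm i : Fin n → ℝ)) (Subtype.val_injective.comp e.symm.injective) ?_⟩
  rw [← Function.comp_def, e.symm.surjective.range_comp, Subtype.range_coe]
end

section
/- SAT is homeomorphism-universal for finite simplicial complexes: for every geometric simplicial complex K in a Euclidean space (Fin n → ℝ) with finitely many faces, there exist a natural number d and a CNF formula Φ over variables Fin d such that the induced cubical complex N(disc(Φ)) is homeomorphic to the underlying space |K| of K. -/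
/-- The discrete solution space of a CNF formula: a clause is a finite set of
literals `(i, b)`, a CNF formula is a finite set of clauses, and an assignment
satisfies the formula if every clause contains a literal it makes true. -/
def cnfDisc {V : Type*} (Φ : Finset (Finset (V × Bool))) : Set (V → Bool) :=
  {x | ∀ C ∈ Φ, ∃ l ∈ C, x l.1 = l.2}

/-- Every set of assignments of finitely many variables is the solution set of a CNF formula. -/
theorem exists_cnfDisc_eq {V : Type*} [Finite V] (X : Set (V → Bool)) :
    ∃ Φ : Finset (Finset (V × Bool)), cnfDisc Φ = X := by
  classical
  cases nonempty_fintype V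
  refine ⟨(Finset.univ.filter (· ∉ X)).image
    fun a => Finset.univ.image fun i => (i, !(a i)), Set.ext fun x => ?_⟩
  simp only [cnfDisc, Set.mem_ofPred_eq, Finset.forall_mem_image, Finset.exists_mem_image,
    Finset.mem_filter, Finset.mem_univ, true_and]
  constructor
  · intro h
    by_contra hx
    obtain ⟨i, hi⟩ := h hx
    simp at hi
  · intro hx a ha
    by_contra! h
    refine ha ?_
    convert hx using 1
    funext i
    have := h i
    revert this
    cases x i <;> cases a i <;> simp

/-- Two points of the cube on a common ray from the origin, both with a coordinate equal to `1`,
coincide. -/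
theorem eq_of_smul_eq_smul_of_exists_eq_one {ι : Type*} {p q : ι → ℝ} {r s : ℝ} (hr : 0 < r) (hs : 0 < s)
    (hp : ∀ i, p i ≤ 1) (hq : ∀ i, q i ≤ 1) (hp1 : ∃ i, p i = 1) (hq1 : ∃ i, q i = 1)
    (h : r • p = s • q) : p = q := by
  have h' : ∀ i, r * p i = s * q i := fun i => congrFun h i
  obtain ⟨i, hi⟩ := hp1
  obtain ⟨j, hj⟩ := hq1
  have hrs : r = s := by
    have h1 := h' i
    have h2 := h' j
    rw [hi] at h1
    rw [hj] at h2
    nlinarith [hq i, hp j]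
  subst hrs
  exact smul_right_injective _ hr.ne' h

section

variable {ι E : Type*} [Fintype ι]

/-- The Boolean vertices which are indicators of the nonempty members of a family of finite sets
span the points of the cube whose support is in the family and with some coordinate equal to `1`. -/
theorem mem_inducedCubicalComplex_indicator_iff {F : Set (Finset ι)}
    (hF : ∀ a ∈ F, a.Nonempty) (hdown : ∀ a ∈ F, ∀ b ⊆ a, b.Nonempty → b ∈ F) {p : ι → ℝ} :
    p ∈ inducedCubicalComplex {x : ι → Bool | Finset.univ.filter (fun i => x i = true) ∈ F} ↔
      (∀ i, 0 ≤ p i ∧ p i ≤ 1) ∧ (∃ i, p i = 1) ∧ ∃ a ∈ F, ∀ i ∉ a, p i = 0 := by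
  classical
  refine and_congr_right fun _ => ⟨fun h => ⟨?_, ?_⟩, ?_⟩
  · obtain ⟨i, hi⟩ := hF _ (h (fun i => decide (p i = 1)) fun i => by
      constructor <;> intro h <;> simp [h])
    exact ⟨i, by simpa using hi⟩
  · refine ⟨_, h (fun i => decide (p i ≠ 0)) fun i => by
      constructor <;> intro h <;> simp [h], fun i hi => by simpa using hi⟩
  · rintro ⟨⟨i, hi⟩, a, ha, hpa⟩ x hx
    refine hdown a ha _ (fun j hj => ?_) ⟨i, by simpa using (hx i).2 hi⟩
    by_contra hja
    simp [(hx j).1 (hpa j hja)] at hj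

/-- The points of the cube with some coordinate equal to `1` and support in a finite family of
finite sets form a compact set. -/
theorem isCompact_setOf_exists_eq_one_support (F : Set (Finset ι)) :
    IsCompact {p : ι → ℝ | (∀ i, 0 ≤ p i ∧ p i ≤ 1) ∧ (∃ i, p i = 1) ∧
      ∃ a ∈ F, ∀ i ∉ a, p i = 0} := by
  have hc : IsCompact (Set.univ.pi fun _ : ι => Set.Icc (0 : ℝ) 1) :=
    isCompact_univ_pi fun _ => isCompact_Icc
  have hone : IsClosed {p : ι → ℝ | ∃ i, p i = 1} := by
    simp only [Set.ofPred_exists]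
    exact isClosed_iUnion_of_finite fun i => isClosed_eq (continuous_apply i) continuous_const
  have hsupp : IsClosed {p : ι → ℝ | ∃ a ∈ F, ∀ i ∉ a, p i = 0} := by
    have : {p : ι → ℝ | ∃ a ∈ F, ∀ i ∉ a, p i = 0} =
        ⋃ a ∈ F, ⋂ i, ⋂ (_ : i ∉ a), {p : ι → ℝ | p i = 0} := by ext; simp
    rw [this]
    exact F.toFinite.isClosed_biUnion fun a _ => isClosed_iInter fun i => isClosed_iInter fun _ =>
      isClosed_eq (continuous_apply i) continuous_const
  convert hc.inter_right (hone.inter hsupp) using 1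
  ext p
  simp only [Set.mem_inter_iff, Set.mem_univ_pi, Set.mem_Icc, Set.mem_ofPred_eq]

variable [AddCommGroup E] [Module ℝ E]

theorem mem_convexHull_map_iff (v : ι ↪ E) (a : Finset ι) (x : E) :
    x ∈ convexHull ℝ (a.map v : Set E) ↔ ∃ w : ι → ℝ, (∀ i, 0 ≤ w i) ∧ (∀ i ∉ a, w i = 0) ∧
      ∑ i, w i = 1 ∧ ∑ i, w i • v i = x := by
  classical
  rw [Finset.mem_convexHull']
  simp only [Finset.forall_mem_map, Finset.sum_map]
  constructor
  · rintro ⟨w, h0, h1, h2⟩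
    refine ⟨fun i => if i ∈ a then w (v i) else 0, fun i => ?_, fun i hi => by simp [hi], ?_, ?_⟩
    · dsimp only
      split_ifs with h
      exacts [h0 i h, le_rfl]
    · simpa [Finset.sum_ite_mem] using h1
    · simpa [ite_smul, Finset.sum_ite_mem] using h2
  · rintro ⟨w, h0, ha, h1, h2⟩
    refine ⟨Function.extend v w 0, fun i _ => ?_, ?_, ?_⟩
    · simpa [v.injective.extend_apply] using h0 i
    · simp only [v.injective.extend_apply]
      rw [← h1]
      exact Finset.sum_subset (Finset.subset_univ _) fun i _ hi => ha i hi
    · simp only [v.injective.extend_apply]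
      rw [← h2]
      exact Finset.sum_subset (Finset.subset_univ _) fun i _ hi => by simp [ha i hi]

theorem eq_of_affineIndependent_map {v : ι ↪ E} {a : Finset ι}
    (hv : AffineIndependent ℝ ((↑) : (a.map v) → E)) {w w' : ι → ℝ}
    (hw : ∀ i ∉ a, w i = 0) (hw' : ∀ i ∉ a, w' i = 0) (hsum : ∑ i, w i = ∑ i, w' i)
    (hcomb : ∑ i, w i • v i = ∑ i, w' i • v i) : w = w' := by
  let g : a ↪ a.map v := ⟨fun i => ⟨v i, Finset.mem_map_of_mem v i.2⟩,
    fun i j h => Subtype.ext (v.injective (congrArg Subtype.val h))⟩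
  have hva : AffineIndependent ℝ (fun i : a => v i) := hv.comp_embedding g
  rw [affineIndependent_iff] at hva
  funext i
  by_cases hi : i ∈ a
  · refine sub_eq_zero.1 (hva Finset.univ (fun j => w j - w' j) ?_ ?_ ⟨i, hi⟩ (Finset.mem_univ _))
    · rw [Finset.sum_coe_sort a fun j => w j - w' j,
        Finset.sum_subset (Finset.subset_univ a) fun j _ hj => by simp [hw j hj, hw' j hj],
        Finset.sum_sub_distrib, hsum, sub_self]
    · rw [Finset.sum_coe_sort a fun j => (w j - w' j) • v j,
        Finset.sum_subset (Finset.subset_univ a) fun j _ hj => by simp [hw j hj, hw' j hj]]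
      simp [sub_smul, Finset.sum_sub_distrib, hcomb]
  · rw [hw i hi, hw' i hi]

/-- Barycentric coordinates in a geometric simplicial complex are unique. -/
theorem Geometry.SimplicialComplex.barycentric_unique_s1 {K : Geometry.SimplicialComplex ℝ E}
    {v : ι ↪ E} {a b : Finset ι} (ha : a.map v ∈ K.faces) (hb : b.map v ∈ K.faces)
    {w w' : ι → ℝ} (hw0 : ∀ i, 0 ≤ w i) (hw0' : ∀ i, 0 ≤ w' i)
    (hw : ∀ i ∉ a, w i = 0) (hw' : ∀ i ∉ b, w' i = 0) (hsum : ∑ i, w i = 1)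
    (hsum' : ∑ i, w' i = 1) (hcomb : ∑ i, w i • v i = ∑ i, w' i • v i) : w = w' := by
  classical
  have hx := K.inter_subset_convexHull ha hb
    ⟨(mem_convexHull_map_iff v a _).2 ⟨w, hw0, hw, hsum, rfl⟩,
      (mem_convexHull_map_iff v b _).2 ⟨w', hw0', hw', hsum', hcomb.symm⟩⟩
  rw [← Finset.coe_inter, ← Finset.map_inter, mem_convexHull_map_iff] at hx
  obtain ⟨u, -, hu, hu1, hux⟩ := hx
  exact (eq_of_affineIndependent_map (K.indep ha) hw (fun i hi => hu i (by simp [hi]))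
    (hsum.trans hu1.symm) hux.symm).trans
    (eq_of_affineIndependent_map (K.indep hb) hw' (fun i hi => hu i (by simp [hi]))
      (hsum'.trans hu1.symm) (hux.symm ▸ hcomb.symm)).symm

variable [TopologicalSpace E] [IsTopologicalAddGroup E] [ContinuousSMul ℝ E] [T2Space E]

/-- Radial projection identifies a simplicial complex with the cubical complex induced by the
indicators of its faces. -/
theorem Geometry.SimplicialComplex.nonempty_homeomorph_inducedCubicalComplex_s1
    (K : Geometry.SimplicialComplex ℝ E) (v : ι ↪ E) (hv : Set.range v = K.vertices) :
    Nonempty (inducedCubicalComplex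
      {x : ι → Bool | (Finset.univ.filter fun i => x i = true).map v ∈ K.faces} ≃ₜ K.space) := by
  classical
  let F : Set (Finset ι) := {a | a.map v ∈ K.faces}
  have hF : ∀ a ∈ F, a.Nonempty := fun a ha =>
    Finset.map_nonempty.1 (K.nonempty_of_mem_faces ha)
  have hdown : ∀ a ∈ F, ∀ b ⊆ a, b.Nonempty → b ∈ F := fun a ha b hb hb' =>
    K.down_closed ha (Finset.map_subset_map.2 hb) (hb'.map)
  let N : Set (ι → ℝ) := {p | (∀ i, 0 ≤ p i ∧ p i ≤ 1) ∧ (∃ i, p i = 1) ∧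
    ∃ a ∈ F, ∀ i ∉ a, p i = 0}
  have hN : inducedCubicalComplex
      {x : ι → Bool | (Finset.univ.filter fun i => x i = true).map v ∈ K.faces} = N :=
    Set.ext fun p => mem_inducedCubicalComplex_indicator_iff hF hdown
  rw [hN]
  have : CompactSpace N :=
    isCompact_iff_compactSpace.1 (isCompact_setOf_exists_eq_one_support F)
  have hpos : ∀ p ∈ N, 0 < ∑ i, p i := by
    rintro p ⟨h0, ⟨i, hi⟩, -⟩
    exact Finset.sum_pos' (fun j _ => (h0 j).1) ⟨i, Finset.mem_univ _, by simp [hi]⟩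
  have hsum : ∀ p ∈ N, ∑ i, (∑ j, p j)⁻¹ * p i = 1 := fun p hp => by
    rw [← Finset.mul_sum, inv_mul_cancel₀ (hpos p hp).ne']
  have hnonneg : ∀ p ∈ N, ∀ i, 0 ≤ (∑ j, p j)⁻¹ * p i := fun p hp i =>
    mul_nonneg (inv_nonneg.2 (hpos p hp).le) (hp.1 i).1
  let f : N → K.space := fun p => ⟨∑ i, ((∑ j, p.1 j)⁻¹ * p.1 i) • v i, by
    obtain ⟨p, hp⟩ := p
    obtain ⟨a, ha, hpa⟩ := hp.2.2
    exact K.convexHull_subset_space ha ((mem_convexHull_map_iff v a _).2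
      ⟨_, hnonneg p hp, fun i hi => by simp [hpa i hi], hsum p hp, rfl⟩)⟩
  have hf : Continuous f := by
    refine Continuous.subtype_mk (continuous_finsetSum _ fun i _ => ?_) _
    refine Continuous.smul (Continuous.mul (Continuous.inv₀ ?_ fun p => (hpos _ p.2).ne') ?_)
      continuous_const
    · exact continuous_finsetSum _ fun j _ => (continuous_apply j).comp continuous_subtype_val
    · exact (continuous_apply i).comp continuous_subtype_val
  have hbij : Function.Bijective f := by
    constructor
    · rintro ⟨p, hp⟩ ⟨q, hq⟩ hpq
      obtain ⟨a, ha, hpa⟩ := hp.2.2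
      obtain ⟨b, hb, hqb⟩ := hq.2.2
      have h := K.barycentric_unique_s1 ha hb (hnonneg p hp) (hnonneg q hq)
        (fun i hi => by simp [hpa i hi]) (fun i hi => by simp [hqb i hi]) (hsum p hp) (hsum q hq)
        (congrArg Subtype.val hpq)
      exact Subtype.ext (eq_of_smul_eq_smul_of_exists_eq_one (inv_pos.2 (hpos p hp))
        (inv_pos.2 (hpos q hq)) (fun i => (hp.1 i).2) (fun i => (hq.1 i).2) hp.2.1 hq.2.1 h)
    · rintro ⟨x, hx⟩
      obtain ⟨s, hs, hxs⟩ := Geometry.SimplicialComplex.mem_space_iff.1 hx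
      obtain ⟨a, rfl⟩ : ∃ a : Finset ι, s = a.map v := by
        have : (s : Set E) ⊆ Set.range v := by
          rw [hv, Geometry.SimplicialComplex.vertices_eq]
          exact Set.subset_biUnion_of_mem (u := fun t : Finset E => (t : Set E)) hs
        refine ⟨s.preimage v v.injective.injOn, Finset.ext fun y => ?_⟩
        simp only [Finset.mem_map, Finset.mem_preimage]
        exact ⟨fun hy => (this hy).imp fun i hi => ⟨by rwa [hi], hi⟩, fun ⟨i, hi, h⟩ => h ▸ hi⟩
      obtain ⟨w, hw0, hwa, hw1, hwx⟩ := (mem_convexHull_map_iff v a x).1 hxs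
      obtain ⟨m, -, hm⟩ := Finset.exists_max_image Finset.univ w
        ((hF a hs).mono (Finset.subset_univ a))
      have hm0 : 0 < w m := by
        refine (hw0 m).lt_of_ne' fun h => ?_
        have : ∀ i, w i = 0 := fun i => le_antisymm (h ▸ hm i (Finset.mem_univ i)) (hw0 i)
        simp [this] at hw1
      refine ⟨⟨fun i => (w m)⁻¹ * w i, fun i => ⟨mul_nonneg (inv_nonneg.2 hm0.le) (hw0 i), ?_⟩,
        ⟨m, inv_mul_cancel₀ hm0.ne'⟩, a, hs, fun i hi => by simp [hwa i hi]⟩, ?_⟩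
      · rw [inv_mul_le_one₀ hm0]
        exact hm i (Finset.mem_univ i)
      · refine Subtype.ext ?_
        simp only [f]
        rw [← hwx]
        refine Finset.sum_congr rfl fun i _ => ?_
        rw [← Finset.mul_sum, hw1, mul_one, inv_inv, mul_inv_cancel_left₀ hm0.ne']
  exact ⟨hf.homeoOfEquivCompactToT2 (f := Equiv.ofBijective f hbij)⟩

end

/-- SAT is homeomorphism-universal for finite simplicial complexes. -/
theorem sat_homeomorphism_universal
    (n : ℕ) (K : Geometry.SimplicialComplex ℝ (Fin n → ℝ)) (hK : K.faces.Finite) :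
    ∃ (d : ℕ) (Φ : Finset (Finset (Fin d × Bool))),
      Nonempty ((inducedCubicalComplex (cnfDisc Φ)) ≃ₜ K.space) := by
  have hfin : K.vertices.Finite := by
    rw [Geometry.SimplicialComplex.vertices_eq]
    exact hK.biUnion fun s _ => s.finite_toSet
  have := hfin.to_subtype
  obtain ⟨d, ⟨e⟩⟩ := Finite.exists_equiv_fin K.vertices
  obtain ⟨Φ, hΦ⟩ := exists_cnfDisc_eq
    {x : Fin d → Bool | (Finset.univ.filter fun i => x i = true).map
      (e.symm.toEmbedding.trans (Function.Embedding.subtype _)) ∈ K.faces}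
  refine ⟨d, Φ, ?_⟩
  rw [hΦ]
  refine K.nonempty_homeomorph_inducedCubicalComplex_s1 _ (Set.ext fun x => ?_)
  refine (e.symm.surjective.exists (p := fun y : K.vertices => (y : Fin n → ℝ) = x)).symm.trans ?_
  simp
end

section
/- For every CNF formula Ψ over variables Fin d there exists a CNF formula Φ over a variable set Fin d ⊕ Fin k, each of whose clauses has at most 3 literals, such that the induced cubical complex N(disc(Φ)) is homotopy equivalent to the induced cubical complex N(disc(Ψ)). -/
/-- The vertex of the unit interval encoding a Boolean value. -/
def boolVertex (b : Bool) : ℝ := cond b 1 0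

/-- The points of the unit cube at which every clause of `Φ` contains a literal attaining exactly
its Boolean value. -/
def literalComplex {V : Type*} (Φ : Finset (Finset (V × Bool))) : Set (V → ℝ) :=
  {p | (∀ i, 0 ≤ p i ∧ p i ≤ 1) ∧ ∀ C ∈ Φ, ∃ l ∈ C, p l.1 = boolVertex l.2}

/-- A formula is tautology-free if no clause contains a literal together with its negation. -/
def TautologyFree {V : Type*} (Φ : Finset (Finset (V × Bool))) : Prop :=
  ∀ C ∈ Φ, ∀ l ∈ C, (l.1, !l.2) ∉ C

theorem inducedCubicalComplex_cnfDisc {V : Type*} {Φ : Finset (Finset (V × Bool))}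
    (hΦ : TautologyFree Φ) : inducedCubicalComplex (cnfDisc Φ) = literalComplex Φ := by
  classical
  ext p
  refine and_congr_right fun hp => ⟨fun h C hC => ?_, fun h v hv C hC => ?_⟩
  · by_contra! hne
    obtain ⟨l, hl, hvl⟩ := h (fun i => if p i = 1 then true else if p i = 0 then false else
      decide ((i, false) ∈ C)) (fun i => ⟨fun h0 => by simp [h0], fun h1 => by simp [h1]⟩) C hC
    obtain ⟨i, b⟩ := l
    have hb := hne _ hl
    have ht := hΦ C hC _ hl
    dsimp only at hvl
    cases b <;> split_ifs at hvl <;> simp_all [boolVertex]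
  · obtain ⟨⟨i, b⟩, hl, hpl⟩ := h C hC
    refine ⟨_, hl, ?_⟩
    cases b
    · exact (hv i).1 hpl
    · exact (hv i).2 hpl

theorem exists_tautologyFree_cnfDisc_eq {V : Type*} (Φ : Finset (Finset (V × Bool))) :
    ∃ Φ' : Finset (Finset (V × Bool)), TautologyFree Φ' ∧ cnfDisc Φ' = cnfDisc Φ := by
  classical
  refine ⟨Φ.filter fun C => ∀ l ∈ C, (l.1, !l.2) ∉ C, fun C hC => (Finset.mem_filter.1 hC).2, ?_⟩
  ext x
  refine ⟨fun h C hC => ?_, fun h C hC => h C (Finset.mem_filter.1 hC).1⟩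
  by_cases hT : ∀ l ∈ C, (l.1, !l.2) ∉ C
  · exact h C (Finset.mem_filter.2 ⟨hC, hT⟩)
  · push Not at hT
    obtain ⟨l, hl, hl'⟩ := hT
    by_cases hx : x l.1 = l.2
    · exact ⟨l, hl, hx⟩
    · exact ⟨_, hl', by cases h1 : x l.1 <;> cases h2 : l.2 <;> simp_all⟩

/-- Maps into the literal complex are homotopic if at each point every clause has a literal that
both of them satisfy. -/
theorem literalComplex_homotopic {X V : Type*} [TopologicalSpace X]
    {Φ : Finset (Finset (V × Bool))} (f g : C(X, literalComplex Φ))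
    (h : ∀ x, ∀ C ∈ Φ, ∃ l ∈ C,
      (f x).1 l.1 = boolVertex l.2 ∧ (g x).1 l.1 = boolVertex l.2) :
    f.Homotopic g := by
  refine ⟨⟨⟨fun y => ⟨fun i => (1 - (y.1 : ℝ)) * (f y.2).1 i + y.1 * (g y.2).1 i, ?_, ?_⟩, ?_⟩,
    fun x => ?_, fun x => ?_⟩⟩
  · intro i
    have h0 := y.1.2.1
    have h1 := y.1.2.2
    have hf := (f y.2).2.1 i
    have hg := (g y.2).2.1 i
    constructor <;> nlinarith
  · intro C hC
    obtain ⟨l, hl, hfl, hgl⟩ := h y.2 C hC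
    exact ⟨l, hl, by simp only [hfl, hgl]; ring⟩
  · have hf (i : V) : Continuous fun x => (f x).1 i :=
      (continuous_apply i).comp (continuous_subtype_val.comp f.continuous)
    have hg (i : V) : Continuous fun x => (g x).1 i :=
      (continuous_apply i).comp (continuous_subtype_val.comp g.continuous)
    refine Continuous.subtype_mk (continuous_pi fun i => ?_) _
    have ht : Continuous fun y : unitInterval × X => (y.1 : ℝ) := by fun_prop
    exact ((continuous_const.sub ht).mul ((hf i).comp continuous_snd)).add
      (ht.mul ((hg i).comp continuous_snd))
  · ext i; simp
  · ext i; simp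

/-- A self-map of the unit interval collapsing neighbourhoods of both endpoints. -/
noncomputable def endpointCollapse (x : ℝ) : ℝ := max 0 (min 1 (2 * x - 1 / 2))

theorem continuous_endpointCollapse : Continuous endpointCollapse := by
  unfold endpointCollapse; fun_prop

theorem endpointCollapse_mem (x : ℝ) : 0 ≤ endpointCollapse x ∧ endpointCollapse x ≤ 1 := by
  simp [endpointCollapse]

theorem endpointCollapse_eq_boolVertex {x : ℝ} {b : Bool} (h : |x - boolVertex b| ≤ 1 / 4) :
    endpointCollapse x = boolVertex b := by
  rw [abs_le] at h
  cases b <;> simp only [boolVertex, cond_true, cond_false] at h ⊢ <;> unfold endpointCollapse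
  · exact max_eq_left ((min_le_right _ _).trans (by linarith))
  · rw [min_eq_left (by linarith)]; simp

theorem endpointCollapse_boolVertex (b : Bool) :
    endpointCollapse (boolVertex b) = boolVertex b :=
  endpointCollapse_eq_boolVertex (by simp)

/-- A continuous measure, with values in the unit interval, of how far `p` is from satisfying a
literal of `C`. -/
noncomputable def clauseGap {V : Type*} (C : Finset (V × Bool)) (p : V → ℝ) : ℝ :=
  ∏ l ∈ C, min 1 (4 * |p l.1 - boolVertex l.2|)

theorem continuous_clauseGap {V : Type*} (C : Finset (V × Bool)) : Continuous (clauseGap C) := by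
  unfold clauseGap; fun_prop

theorem clauseGap_mem {V : Type*} (C : Finset (V × Bool)) (p : V → ℝ) :
    0 ≤ clauseGap C p ∧ clauseGap C p ≤ 1 :=
  ⟨Finset.prod_nonneg fun _ _ => by positivity,
    Finset.prod_le_one (fun _ _ => by positivity) fun _ _ => min_le_left _ _⟩

theorem clauseGap_eq_zero {V : Type*} {C : Finset (V × Bool)} {p : V → ℝ}
    (h : ∃ l ∈ C, p l.1 = boolVertex l.2) : clauseGap C p = 0 := by
  obtain ⟨l, hl, h⟩ := h
  exact Finset.prod_eq_zero hl (by simp [h])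

theorem clauseGap_eq_one {V : Type*} {C : Finset (V × Bool)} {p : V → ℝ}
    (h : ¬∃ l ∈ C, endpointCollapse (p l.1) = boolVertex l.2) : clauseGap C p = 1 := by
  refine Finset.prod_eq_one fun l hl => min_eq_left ?_
  by_contra hlt
  exact h ⟨l, hl, endpointCollapse_eq_boolVertex (by linarith)⟩

open scoped Classical in
/-- The clause obtained by renaming variables along `f`. -/
noncomputable def renameClause {V W : Type*} (f : V → W) (C : Finset (V × Bool)) :
    Finset (W × Bool) :=
  C.image (Prod.map f id)

theorem exists_mem_renameClause {V W : Type*} {f : V → W} {C : Finset (V × Bool)}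
    {P : W × Bool → Prop} :
    (∃ l ∈ renameClause f C, P l) ↔ ∃ l ∈ C, P (f l.1, l.2) := by
  classical
  exact Finset.exists_mem_image

theorem mem_renameClause {V W : Type*} {f : V → W} (hf : f.Injective) {C : Finset (V × Bool)}
    {i : V} {b : Bool} : (f i, b) ∈ renameClause f C ↔ (i, b) ∈ C := by
  classical
  simp [renameClause, hf.eq_iff]

theorem card_renameClause {V W : Type*} {f : V → W} (hf : f.Injective) (C : Finset (V × Bool)) :
    (renameClause f C).card = C.card := by
  classical
  exact Finset.card_image_of_injective _ (hf.prodMap Function.injective_id)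

theorem renameClause_injective {V W : Type*} {f : V → W} (hf : f.Injective) :
    (renameClause f).Injective := by
  classical
  exact Finset.image_injective (hf.prodMap Function.injective_id)

theorem none_notMem_renameClause_some {V : Type*} (C : Finset (V × Bool)) (b : Bool) :
    ((none : Option V), b) ∉ renameClause some C := by
  classical
  simp [renameClause]

/-- The formula obtained from `insert (A ∪ B) Φ` by splitting the clause `A ∪ B` into `A ∨ y` and
`B ∨ ¬y`, where `y` is the fresh variable `none`. -/
noncomputable def splitCnf {V : Type*} [DecidableEq V] (Φ : Finset (Finset (V × Bool)))
    (A B : Finset (V × Bool)) : Finset (Finset (Option V × Bool)) :=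
  insert (insert (none, true) (renameClause some A))
    (insert (insert (none, false) (renameClause some B)) (Φ.image (renameClause some)))

theorem forall_mem_splitCnf {V : Type*} [DecidableEq V] {Φ : Finset (Finset (V × Bool))}
    {A B : Finset (V × Bool)} {P : Option V × Bool → Prop} :
    (∀ C ∈ splitCnf Φ A B, ∃ l ∈ C, P l) ↔
      (P (none, true) ∨ ∃ l ∈ A, P (some l.1, l.2)) ∧
      (P (none, false) ∨ ∃ l ∈ B, P (some l.1, l.2)) ∧
      ∀ C ∈ Φ, ∃ l ∈ C, P (some l.1, l.2) := by
  classical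
  simp only [splitCnf, Finset.forall_mem_insert, Finset.exists_mem_insert, Finset.forall_mem_image,
    exists_mem_renameClause]

theorem forall_mem_insert_union {V : Type*} [DecidableEq V] {Φ : Finset (Finset (V × Bool))}
    {A B : Finset (V × Bool)} {P : V × Bool → Prop} :
    (∀ C ∈ insert (A ∪ B) Φ, ∃ l ∈ C, P l) ↔
      ((∃ l ∈ A, P l) ∨ ∃ l ∈ B, P l) ∧ ∀ C ∈ Φ, ∃ l ∈ C, P l := by
  simp only [Finset.forall_mem_insert, Finset.mem_union, or_and_right, exists_or]

theorem nonempty_homotopyEquiv_splitCnf {V : Type*} [DecidableEq V]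
    (Φ : Finset (Finset (V × Bool))) (A B : Finset (V × Bool)) :
    Nonempty (ContinuousMap.HomotopyEquiv
      (literalComplex (splitCnf Φ A B)) (literalComplex (insert (A ∪ B) Φ))) := by
  have collapse {C : Finset (V × Bool)} {p : V → ℝ} (h : ∃ l ∈ C, p l.1 = boolVertex l.2) :
      ∃ l ∈ C, p l.1 = boolVertex l.2 ∧ endpointCollapse (p l.1) = boolVertex l.2 := by
    obtain ⟨l, hl, h⟩ := h
    exact ⟨l, hl, h, h ▸ endpointCollapse_boolVertex _⟩
  let f : C(literalComplex (splitCnf Φ A B), literalComplex (insert (A ∪ B) Φ)) :=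
    ⟨fun q => ⟨fun i => q.1 (some i), fun i => q.2.1 _, by
      have h := forall_mem_splitCnf.1 q.2.2
      refine forall_mem_insert_union.2 ⟨?_, h.2.2⟩
      rcases h.1 with h1 | hA
      · rcases h.2.1 with h0 | hB
        · simp [h1, boolVertex] at h0
        · exact Or.inr hB
      · exact Or.inl hA⟩, by
      refine Continuous.subtype_mk (continuous_pi fun i => ?_) _
      exact (continuous_apply (some i)).comp continuous_subtype_val⟩
  let s (p : V → ℝ) : ℝ := (1 + clauseGap A p - clauseGap B p) / 2
  have hs : Continuous s := by
    have hA := continuous_clauseGap A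
    have hB := continuous_clauseGap B
    fun_prop
  have s_mem (p : V → ℝ) : 0 ≤ s p ∧ s p ≤ 1 := by
    have hA := clauseGap_mem A p
    have hB := clauseGap_mem B p
    constructor <;> simp only [s] <;> linarith
  have s_one {p : V → ℝ} (hA : ¬∃ l ∈ A, endpointCollapse (p l.1) = boolVertex l.2)
      (hB : ∃ l ∈ B, p l.1 = boolVertex l.2) : s p = 1 := by
    simp [s, clauseGap_eq_one hA, clauseGap_eq_zero hB]
  have s_zero {p : V → ℝ} (hB : ¬∃ l ∈ B, endpointCollapse (p l.1) = boolVertex l.2)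
      (hA : ∃ l ∈ A, p l.1 = boolVertex l.2) : s p = 0 := by
    simp [s, clauseGap_eq_one hB, clauseGap_eq_zero hA]
  have weaken {C : Finset (V × Bool)} {p : V → ℝ} (h : ∃ l ∈ C, p l.1 = boolVertex l.2) :
      ∃ l ∈ C, endpointCollapse (p l.1) = boolVertex l.2 := by
    obtain ⟨l, hl, -, h⟩ := collapse h
    exact ⟨l, hl, h⟩
  have hc := continuous_endpointCollapse
  let g : C(literalComplex (insert (A ∪ B) Φ), literalComplex (splitCnf Φ A B)) :=
    ⟨fun p => ⟨fun o => o.elim (s p.1) fun i => endpointCollapse (p.1 i), by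
      rintro (_ | i)
      · exact s_mem _
      · exact endpointCollapse_mem _, by
      have h := forall_mem_insert_union.1 p.2.2
      refine forall_mem_splitCnf.2 ⟨?_, ?_, fun C hC => weaken (h.2 C hC)⟩
      · by_cases hA : ∃ l ∈ A, endpointCollapse (p.1 l.1) = boolVertex l.2
        · exact Or.inr hA
        · exact Or.inl (s_one hA (h.1.resolve_left fun h' => hA (weaken h')))
      · by_cases hB : ∃ l ∈ B, endpointCollapse (p.1 l.1) = boolVertex l.2
        · exact Or.inr hB
        · exact Or.inl (s_zero hB (h.1.resolve_right fun h' => hB (weaken h')))⟩, by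
      refine Continuous.subtype_mk (continuous_pi ?_) _
      rintro (_ | i)
      · exact hs.comp continuous_subtype_val
      · exact hc.comp ((continuous_apply i).comp continuous_subtype_val)⟩
  let c : C(literalComplex (splitCnf Φ A B), literalComplex (splitCnf Φ A B)) :=
    ⟨fun q => ⟨fun o => o.elim (q.1 none) fun i => endpointCollapse (q.1 (some i)), by
      rintro (_ | i)
      · exact q.2.1 _
      · exact endpointCollapse_mem _, by
      have h := forall_mem_splitCnf.1 q.2.2
      exact forall_mem_splitCnf.2 ⟨h.1.imp_right (weaken (p := fun i => q.1 (some i))),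
        h.2.1.imp_right (weaken (p := fun i => q.1 (some i))),
        fun C hC => weaken (p := fun i => q.1 (some i)) (h.2.2 C hC)⟩⟩, by
      refine Continuous.subtype_mk (continuous_pi ?_) _
      rintro (_ | i)
      · exact (continuous_apply none).comp continuous_subtype_val
      · exact hc.comp ((continuous_apply (some i)).comp continuous_subtype_val)⟩
  have hgc : (g.comp f).Homotopic c := by
    refine literalComplex_homotopic _ _ fun q => ?_
    have h := forall_mem_splitCnf.1 q.2.2
    have hf := forall_mem_insert_union.1 (f q).2.2
    refine forall_mem_splitCnf.2 ⟨?_, ?_, fun C hC => ?_⟩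
    · by_cases hA : ∃ l ∈ A, endpointCollapse (q.1 (some l.1)) = boolVertex l.2
      · obtain ⟨l, hl, hA⟩ := hA
        exact Or.inr ⟨l, hl, hA, hA⟩
      · have hA' := fun h' => hA (weaken (p := fun i => q.1 (some i)) h')
        exact Or.inl ⟨s_one hA (hf.1.resolve_left hA'), h.1.resolve_right hA'⟩
    · by_cases hB : ∃ l ∈ B, endpointCollapse (q.1 (some l.1)) = boolVertex l.2
      · obtain ⟨l, hl, hB⟩ := hB
        exact Or.inr ⟨l, hl, hB, hB⟩
      · have hB' := fun h' => hB (weaken (p := fun i => q.1 (some i)) h')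
        exact Or.inl ⟨s_zero hB (hf.1.resolve_right hB'), h.2.1.resolve_right hB'⟩
    · obtain ⟨l, hl, hC⟩ := weaken (p := fun i => q.1 (some i)) (h.2.2 C hC)
      exact ⟨l, hl, hC, hC⟩
  have hci : (ContinuousMap.id _).Homotopic c := by
    refine literalComplex_homotopic _ _ fun q => ?_
    have h := forall_mem_splitCnf.1 q.2.2
    exact forall_mem_splitCnf.2 ⟨h.1.imp (fun h => ⟨h, h⟩) (collapse (p := fun i => q.1 (some i))),
      h.2.1.imp (fun h => ⟨h, h⟩) (collapse (p := fun i => q.1 (some i))),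
      fun C hC => collapse (p := fun i => q.1 (some i)) (h.2.2 C hC)⟩
  exact ⟨⟨f, g, hgc.trans hci.symm,
    (literalComplex_homotopic _ _ fun p C hC => collapse (p.2.2 C hC)).symm⟩⟩

theorem TautologyFree.splitCnf {V : Type*} [DecidableEq V] {Φ : Finset (Finset (V × Bool))}
    {A B : Finset (V × Bool)} (h : TautologyFree (insert (A ∪ B) Φ)) :
    TautologyFree (splitCnf Φ A B) := by
  classical
  have hinj := Option.some_injective V
  have hAB := h _ (Finset.mem_insert_self _ _)
  have key {D : Finset (V × Bool)} (hD : ∀ l ∈ D, (l.1, !l.2) ∉ D) (b : Bool) :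
      ∀ l ∈ insert ((none : Option V), b) (renameClause some D),
        (l.1, !l.2) ∉ insert ((none : Option V), b) (renameClause some D) := by
    rintro ⟨_ | i, b'⟩ hl hl'
    · simp [none_notMem_renameClause_some] at hl hl'
      simp [hl] at hl'
    · simp only [Finset.mem_insert, Prod.mk.injEq, reduceCtorEq, false_and, false_or,
        mem_renameClause hinj] at hl hl'
      exact hD _ hl hl'
  intro C hC
  simp only [_root_.splitCnf, Finset.mem_insert, Finset.mem_image] at hC
  rcases hC with rfl | rfl | ⟨D, hD, rfl⟩
  · exact key (fun l hl hl' => hAB l (Finset.mem_union_left _ hl) (Finset.mem_union_left _ hl')) _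
  · exact key (fun l hl hl' => hAB l (Finset.mem_union_right _ hl) (Finset.mem_union_right _ hl')) _
  · rintro ⟨_ | i, b'⟩ hl hl'
    · exact none_notMem_renameClause_some _ _ hl
    · rw [mem_renameClause hinj] at hl hl'
      exact h D (Finset.mem_insert_of_mem hD) _ hl hl'

theorem sum_excess_splitCnf_le {V : Type*} [DecidableEq V] (Φ : Finset (Finset (V × Bool)))
    (A B : Finset (V × Bool)) :
    ∑ C ∈ splitCnf Φ A B, (C.card - 3) ≤
      (A.card + 1 - 3) + ((B.card + 1 - 3) + ∑ C ∈ Φ, (C.card - 3)) := by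
  classical
  have hinj := Option.some_injective V
  have insert_le (C : Finset (Option V × Bool)) (Γ : Finset (Finset (Option V × Bool))) :
      ∑ D ∈ insert C Γ, (D.card - 3) ≤ (C.card - 3) + ∑ D ∈ Γ, (D.card - 3) := by
    by_cases hC : C ∈ Γ
    · simp [hC]
    · rw [Finset.sum_insert hC]
  unfold splitCnf
  refine (insert_le _ _).trans (add_le_add (le_of_eq ?_)
    ((insert_le _ _).trans (add_le_add (le_of_eq ?_) (le_of_eq ?_))))
  · rw [Finset.card_insert_of_notMem (none_notMem_renameClause_some _ _), card_renameClause hinj]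
  · rw [Finset.card_insert_of_notMem (none_notMem_renameClause_some _ _), card_renameClause hinj]
  · rw [Finset.sum_image fun _ _ _ _ h => renameClause_injective hinj h]
    simp only [card_renameClause hinj]

theorem TautologyFree.exists_threeCnf {V : Type} [Fintype V] {Φ : Finset (Finset (V × Bool))}
    (hΦ : TautologyFree Φ) :
    ∃ (W : Type) (_ : Fintype W) (Φ' : Finset (Finset (W × Bool))),
      Fintype.card V ≤ Fintype.card W ∧ TautologyFree Φ' ∧ (∀ C ∈ Φ', C.card ≤ 3) ∧
      Nonempty (ContinuousMap.HomotopyEquiv (literalComplex Φ') (literalComplex Φ)) := by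
  classical
  induction hn : ∑ C ∈ Φ, (C.card - 3) using Nat.strong_induction_on generalizing V with
  | _ n ih =>
  by_cases h3 : ∀ C ∈ Φ, C.card ≤ 3
  · exact ⟨V, inferInstance, Φ, le_rfl, hΦ, h3, ⟨.refl _⟩⟩
  push Not at h3
  obtain ⟨C, hC, hC3⟩ := h3
  obtain ⟨A, hAC, hA⟩ := Finset.exists_subset_card_eq (show 2 ≤ C.card by omega)
  have hins : insert (A ∪ C \ A) (Φ.erase C) = Φ := by
    rw [Finset.union_sdiff_of_subset hAC, Finset.insert_erase hC]
  have hB : (C \ A).card = C.card - 2 := by rw [Finset.card_sdiff_of_subset hAC, hA]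
  have hsum := Finset.add_sum_erase Φ (fun C => C.card - 3) hC
  have hle := sum_excess_splitCnf_le (Φ.erase C) A (C \ A)
  obtain ⟨e⟩ := nonempty_homotopyEquiv_splitCnf (Φ.erase C) A (C \ A)
  rw [← hins] at hΦ
  obtain ⟨W, _, Φ', hcard, hfree, h3, ⟨e'⟩⟩ := ih _ (by omega) hΦ.splitCnf rfl
  rw [hins] at e
  refine ⟨W, inferInstance, Φ', ?_, hfree, h3, ⟨e'.trans e⟩⟩
  rw [Fintype.card_option] at hcard
  omega

theorem TautologyFree.image_renameClause {V W : Type*} [DecidableEq W] (e : V ≃ W)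
    {Φ : Finset (Finset (V × Bool))} (h : TautologyFree Φ) :
    TautologyFree (Φ.image (renameClause e)) := by
  intro C hC
  obtain ⟨D, hD, rfl⟩ := Finset.mem_image.1 hC
  rintro ⟨j, b⟩ hl hl'
  obtain ⟨i, rfl⟩ := e.surjective j
  rw [mem_renameClause e.injective] at hl hl'
  exact h D hD _ hl hl'

theorem nonempty_homeomorph_image_renameClause {V W : Type*} [DecidableEq W] (e : V ≃ W)
    (Φ : Finset (Finset (V × Bool))) :
    Nonempty (literalComplex (Φ.image (renameClause e)) ≃ₜ literalComplex Φ) := by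
  refine ⟨(Homeomorph.piCongrLeft (Y := fun _ => ℝ) e).symm.sets ?_⟩
  ext p
  simp only [literalComplex, Set.mem_ofPred_eq, Finset.forall_mem_image, exists_mem_renameClause,
    Set.mem_preimage]
  refine and_congr (e.forall_congr_left.trans ?_).symm ?_
  · simp
  · rfl

/-- Every CNF formula `Ψ` can be translated into a 3-CNF formula `Φ` (over extra
auxiliary variables) whose induced cubical complex is homotopy equivalent to that
of `Ψ`. -/
theorem cnf_to_threeCnf_homotopyEquiv (d : ℕ) (Ψ : Finset (Finset (Fin d × Bool))) :
    ∃ (k : ℕ) (Φ : Finset (Finset ((Fin d ⊕ Fin k) × Bool))),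
      (∀ C ∈ Φ, C.card ≤ 3) ∧
      Nonempty (ContinuousMap.HomotopyEquiv
        (inducedCubicalComplex (cnfDisc Φ)) (inducedCubicalComplex (cnfDisc Ψ))) := by
  classical
  obtain ⟨Ψ', hfree, hdisc⟩ := exists_tautologyFree_cnfDisc_eq Ψ
  obtain ⟨W, _, Φ, hcard, hΦ, h3, ⟨E⟩⟩ := hfree.exists_threeCnf
  rw [Fintype.card_fin] at hcard
  let e : W ≃ Fin d ⊕ Fin (Fintype.card W - d) := Fintype.equivOfCardEq (by simp; omega)
  obtain ⟨H⟩ := nonempty_homeomorph_image_renameClause e Φ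
  refine ⟨_, Φ.image (renameClause e), ?_, ?_⟩
  · simpa only [Finset.forall_mem_image, card_renameClause e.injective] using h3
  · rw [← hdisc, inducedCubicalComplex_cnfDisc hfree,
      inducedCubicalComplex_cnfDisc (hΦ.image_renameClause e)]
    exact ⟨H.toHomotopyEquiv.trans E⟩
end

section
/- Let Φ be an affine boolean formula over Fin d, i.e. there are m : ℕ, a matrix A : Matrix (Fin m) (Fin d) (ZMod 2) and b : Fin m → ZMod 2 such that disc(Φ) = { x : Fin d → Bool | A.mulVec (ι ∘ x) = b }, where ι : Bool → ZMod 2 sends false to 0 and true to 1. Then the induced cubical complex N(disc(Φ)) is homotopy equivalent to a finite discrete space; that is, there exists a finite set F of points of (Fin d → ℝ) (with the subspace topology, which is discrete) such that N(disc(Φ)) is homotopy equivalent to F. -/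
/-- The inclusion `ι : Bool → ZMod 2`, with `ι false = 0` and `ι true = 1`. -/
def boolToZMod2 (b : Bool) : ZMod 2 := if b then 1 else 0

open Classical in
/-- Scale the coordinates of `p` that do not occur in the linear system `A` by `t`. -/
noncomputable def scaleFreeCoords {m d : ℕ} (A : Matrix (Fin m) (Fin d) (ZMod 2)) (t : ℝ)
    (p : Fin d → ℝ) : Fin d → ℝ :=
  fun i => if ∀ k, A k i = 0 then t * p i else p i

theorem continuous_scaleFreeCoords {m d : ℕ} (A : Matrix (Fin m) (Fin d) (ZMod 2)) :
    Continuous fun q : ℝ × (Fin d → ℝ) => scaleFreeCoords A q.1 q.2 := by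
  refine continuous_pi fun i => ?_
  unfold scaleFreeCoords
  split_ifs <;> fun_prop

theorem scaleFreeCoords_one {m d : ℕ} (A : Matrix (Fin m) (Fin d) (ZMod 2)) (p : Fin d → ℝ) :
    scaleFreeCoords A 1 p = p := by
  ext i; simp [scaleFreeCoords]

theorem scaleFreeCoords_zero_zero {m d : ℕ} (A : Matrix (Fin m) (Fin d) (ZMod 2))
    (p : Fin d → ℝ) :
    scaleFreeCoords A 0 (scaleFreeCoords A 0 p) = scaleFreeCoords A 0 p := by
  ext i
  unfold scaleFreeCoords
  split_ifs <;> simp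

theorem mulVec_eq_of_agree {m d : ℕ} (A : Matrix (Fin m) (Fin d) (ZMod 2))
    {v w : Fin d → ZMod 2} (h : ∀ i, (∀ k, A k i = 0) ∨ v i = w i) :
    A.mulVec v = A.mulVec w := by
  ext k
  simp only [Matrix.mulVec, dotProduct]
  refine Finset.sum_congr rfl fun i _ => ?_
  rcases h i with h | h
  · simp [h k]
  · simp [h]

theorem scaleFreeCoords_mem {m d : ℕ} (A : Matrix (Fin m) (Fin d) (ZMod 2))
    (b : Fin m → ZMod 2) {t : ℝ} (ht : t ∈ Set.Icc (0 : ℝ) 1) {p : Fin d → ℝ}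
    (hp : p ∈ inducedCubicalComplex {x | A.mulVec (boolToZMod2 ∘ x) = b}) :
    scaleFreeCoords A t p ∈ inducedCubicalComplex {x | A.mulVec (boolToZMod2 ∘ x) = b} := by
  classical
  obtain ⟨hc, hX⟩ := hp
  refine ⟨fun i => ?_, fun v hv => ?_⟩
  · unfold scaleFreeCoords
    split_ifs
    · exact ⟨mul_nonneg ht.1 (hc i).1, mul_le_one₀ ht.2 (hc i).1 (hc i).2⟩
    · exact hc i
  · have hw := hX (fun i => if ∀ k, A k i = 0 then decide (p i = 1) else v i) fun i => by
      by_cases hi : ∀ k, A k i = 0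
      · simp only [if_pos hi]
        exact ⟨fun h => by simp [h], fun h => by simp [h]⟩
      · have := hv i
        simp only [scaleFreeCoords, if_neg hi] at this ⊢
        exact this
    rw [Set.mem_ofPred_eq] at hw ⊢
    rw [← hw]
    refine mulVec_eq_of_agree A fun i => ?_
    by_cases hi : ∀ k, A k i = 0
    · exact Or.inl hi
    · exact Or.inr (by simp only [Function.comp_apply, if_neg hi])

/-- A coordinate that is neither `0` nor `1` at a point of the complex of an affine solution set
does not occur in the linear system. -/
theorem eq_zero_or_one_of_mem {m d : ℕ} (A : Matrix (Fin m) (Fin d) (ZMod 2))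
    (b : Fin m → ZMod 2) {p : Fin d → ℝ}
    (hp : p ∈ inducedCubicalComplex {x | A.mulVec (boolToZMod2 ∘ x) = b}) {i : Fin d}
    (hi : ¬ ∀ k, A k i = 0) : p i = 0 ∨ p i = 1 := by
  classical
  by_contra! hne
  refine hi fun k => ?_
  have key (c : Bool) := hp.2 (Function.update (fun j => decide (p j = 1)) i c) fun j => by
    rcases eq_or_ne j i with rfl | hj
    · exact ⟨fun h => absurd h hne.1, fun h => absurd h hne.2⟩
    · simp only [Function.update_of_ne hj]
      exact ⟨fun h => by simp [h], fun h => by simp [h]⟩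
  have h := congrFun ((key true).trans (key false).symm) k
  simp only [Matrix.mulVec, dotProduct, Function.comp_apply] at h
  rw [← Finset.add_sum_erase _ _ (Finset.mem_univ i),
    ← Finset.add_sum_erase _ _ (Finset.mem_univ i),
    Finset.sum_congr rfl (g := fun j => A k j * boolToZMod2
      (Function.update (fun j => decide (p j = 1)) i false j))] at h
  · simpa [boolToZMod2] using h
  · intro j hj
    simp [Function.update_of_ne (Finset.ne_of_mem_erase hj)]

theorem finite_image_scaleFreeCoords_zero {m d : ℕ} (A : Matrix (Fin m) (Fin d) (ZMod 2))
    (b : Fin m → ZMod 2) :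
    (scaleFreeCoords A 0 ''
      inducedCubicalComplex {x | A.mulVec (boolToZMod2 ∘ x) = b}).Finite := by
  refine (Set.Finite.pi' fun _ : Fin d => Set.toFinite ({0, 1} : Set ℝ)).subset ?_
  rintro _ ⟨p, hp, rfl⟩ i
  unfold scaleFreeCoords
  split_ifs with hi
  · simp
  · simpa using eq_zero_or_one_of_mem A b hp hi

/-- The induced cubical complex of the solution set of an affine boolean formula
(solutions of a system of affine equations over `GF(2)`) is homotopy equivalent to
a finite discrete space. -/
theorem affine_solution_space_homotopyEquiv_finite_discrete
    (d m : ℕ) (X : Set (Fin d → Bool))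
    (A : Matrix (Fin m) (Fin d) (ZMod 2)) (b : Fin m → ZMod 2)
    (hX : X = {x : Fin d → Bool | A.mulVec (boolToZMod2 ∘ x) = b}) :
    ∃ F : Finset (Fin d → ℝ),
      Nonempty (ContinuousMap.HomotopyEquiv
        (inducedCubicalComplex X) (↑F : Set (Fin d → ℝ))) := by
  subst hX
  have hfin := finite_image_scaleFreeCoords_zero A b
  have hcont := continuous_scaleFreeCoords A
  refine ⟨hfin.toFinset, ⟨{
    toFun := ⟨fun p => ⟨scaleFreeCoords A 0 p, by simpa using ⟨p.1, p.2, rfl⟩⟩, ?_⟩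
    invFun := ⟨fun q => ⟨q, ?_⟩, ?_⟩
    left_inv := ⟨{
      toFun := fun z => ⟨scaleFreeCoords A z.1 z.2, scaleFreeCoords_mem A b z.1.2 z.2.2⟩
      continuous_toFun := ?_
      map_zero_left := fun p => rfl
      map_one_left := fun p => Subtype.ext (scaleFreeCoords_one A p) }⟩
    right_inv := ?_ }⟩⟩
  · exact (hcont.comp (continuous_const.prodMk continuous_subtype_val)).subtype_mk _
  · obtain ⟨p, hp, h⟩ := hfin.mem_toFinset.1 (Finset.mem_coe.1 q.2)
    exact h ▸ scaleFreeCoords_mem A b ⟨le_rfl, zero_le_one⟩ hp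
  · exact continuous_subtype_val.subtype_mk _
  · exact (hcont.comp ((continuous_subtype_val.comp continuous_fst).prodMk
      (continuous_subtype_val.comp continuous_snd))).subtype_mk _
  · convert ContinuousMap.Homotopic.refl _
    ext1 q
    obtain ⟨p, hp, h⟩ := hfin.mem_toFinset.1 (Finset.mem_coe.1 q.2)
    refine Subtype.ext ?_
    change (q : Fin d → ℝ) = scaleFreeCoords A 0 q
    rw [← h, scaleFreeCoords_zero_zero]
end

section
/- Let Φ be a CNF formula over Fin d each of whose clauses contains at most 2 literals (a 2-SAT formula). Then for every natural number p ≥ 1, the induced cubical complex N(disc(Φ)) is not homotopy equivalent to the p-dimensional unit sphere, i.e. to Metric.sphere (0 : EuclideanSpace ℝ (Fin (p+1))) 1 with its subspace topology. -/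
open Set Metric MeasureTheory

/-- Evaluating `det (1 + t A)` at `t = 1` by Lagrange interpolation. -/
theorem ContinuousLinearMap.det_one_add_eq_sum_lagrange {E : Type*} [NormedAddCommGroup E]
    [NormedSpace ℝ E] [FiniteDimensional ℝ E] (A : E →L[ℝ] E) {s : Finset ℝ}
    (hs : Module.finrank ℝ E < s.card) :
    (1 + A).det = ∑ t ∈ s, (1 + t • A).det * (Lagrange.basis s id t).eval 1 := by
  classical
  let b := Module.finBasis ℝ E
  let M := LinearMap.toMatrix b b (A : E →ₗ[ℝ] E)
  let P : Polynomial ℝ := ((Polynomial.X : Polynomial ℝ) • M.map Polynomial.C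
    + (1 : Matrix _ _ ℝ).map Polynomial.C).det
  have hP (t : ℝ) : P.eval t = (1 + t • A).det := by
    have h1 : (1 + t • A).det = (1 + t • M).det := by
      rw [ContinuousLinearMap.det, ← LinearMap.det_toMatrix b]
      simp [M, LinearMap.toMatrix_one]
    rw [h1]
    simp only [P]
    rw [← Polynomial.coe_evalRingHom, RingHom.map_det]
    congr 1
    ext i j
    by_cases hij : i = j <;> simp [hij] <;> ring
  have hdeg : P.degree < s.card := by
    refine lt_of_le_of_lt Polynomial.degree_le_natDegree ?_
    refine lt_of_le_of_lt (b := (Module.finrank ℝ E : WithBot ℕ)) ?_ (by exact_mod_cast hs)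
    have := Polynomial.natDegree_det_X_add_C_le M 1
    rw [Fintype.card_fin] at this
    exact_mod_cast this
  have := congrArg (Polynomial.eval 1) (Lagrange.eq_interpolate (v := id) (s := s)
    Function.injective_id.injOn hdeg)
  rw [hP, Lagrange.interpolate_apply, Polynomial.eval_finsetSum, one_smul] at this
  simpa [hP] using this

theorem ContinuousLinearMap.det_one_add_pos {E : Type*} [NormedAddCommGroup E]
    [NormedSpace ℝ E] [FiniteDimensional ℝ E] (A : E →L[ℝ] E) (hA : ‖A‖ < 1) :
    0 < (1 + A).det := by
  have hne : ∀ t ∈ Icc (0 : ℝ) 1, (1 + t • A).det ≠ 0 := by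
    intro t ht
    have hn : ‖-(t • A)‖ < 1 := by
      rw [norm_neg, norm_smul, Real.norm_of_nonneg ht.1]
      nlinarith [ht.2, norm_nonneg A]
    have hu := isUnit_one_sub_of_norm_lt_one hn
    rw [sub_neg_eq_add] at hu
    have := (hu.map (ContinuousLinearMap.toLinearMapRingHom (R₁ := ℝ) (M₁ := E))).map LinearMap.det
    exact this.ne_zero
  have hc : ContinuousOn (fun t : ℝ => (1 + t • A).det) (Icc 0 1) :=
    (ContinuousLinearMap.continuous_det.comp (by fun_prop)).continuousOn
  by_contra! h
  have := intermediate_value_Icc' zero_le_one hc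
  have h0 : (0 : ℝ) ∈ Icc (1 + (1 : ℝ) • A).det (1 + (0 : ℝ) • A).det := by
    simp only [one_smul, zero_smul, add_zero]
    refine ⟨h, ?_⟩
    show (0 : ℝ) ≤ LinearMap.det (1 : E →ₗ[ℝ] E)
    simp
  obtain ⟨t, ht, h⟩ := this h0
  exact hne t ht h

/-- A function vanishing outside a ball and Lipschitz on the closed ball is Lipschitz. -/
theorem LipschitzOnWith.extend_zero_closedBall {E F : Type*} [NormedAddCommGroup E]
    [NormedSpace ℝ E] [NormedAddCommGroup F] {K : NNReal} {g : E → F} {r : ℝ}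
    (hg : LipschitzOnWith K g (closedBall 0 r)) (h0 : ∀ x, r ≤ ‖x‖ → g x = 0) :
    LipschitzWith K g := by
  have key : ∀ x y, ‖x‖ ≤ r → r ≤ ‖y‖ → dist (g x) (g y) ≤ K * dist x y := by
    intro x y hx hy
    have hc : ContinuousOn (fun t : ℝ => ‖AffineMap.lineMap x y t‖) (Icc 0 1) := by
      have : Continuous (AffineMap.lineMap x y : ℝ → E) := AffineMap.lineMap_continuous
      fun_prop
    obtain ⟨t, ht, hz⟩ := intermediate_value_Icc zero_le_one hc
      (show r ∈ Icc _ _ by simp [hx, hy])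
    have h1 := hg.dist_le_mul x (by simpa using hx) (AffineMap.lineMap x y t) (by simp [hz])
    rw [h0 _ hz.ge, dist_left_lineMap, Real.norm_of_nonneg ht.1] at h1
    rw [h0 _ hy]
    refine h1.trans (mul_le_mul_of_nonneg_left ?_ K.2)
    exact mul_le_of_le_one_left dist_nonneg ht.2
  refine LipschitzWith.of_dist_le_mul fun x y => ?_
  rcases le_total ‖x‖ r with hx | hx <;> rcases le_total ‖y‖ r with hy | hy
  · exact hg.dist_le_mul x (by simpa using hx) y (by simpa using hy)
  · exact key x y hx hy
  · rw [dist_comm, dist_comm x]; exact key y x hy hx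
  · rw [h0 _ hx, h0 _ hy, dist_self]; positivity

theorem det_fderiv_eq_zero_of_norm_eq_one {E : Type*} [NormedAddCommGroup E]
    [InnerProductSpace ℝ E] [FiniteDimensional ℝ E] {f : E → E} {f' : E →L[ℝ] E} {x : E}
    (hf : HasFDerivAt f f' x) (h1 : ∀ y, ‖f y‖ = 1) : f'.det = 0 := by
  by_contra hdet
  have hsurj : Function.Surjective f' :=
    (LinearMap.equivOfDetNeZero _ hdet).surjective
  have h2 : HasFDerivAt (fun y => ‖f y‖ ^ 2) (2 • (innerSL ℝ (f x)).comp f') x := hf.norm_sq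
  have h3 : HasFDerivAt (fun y => ‖f y‖ ^ 2) (0 : E →L[ℝ] ℝ) x := by
    simpa [h1] using hasFDerivAt_const (1 : ℝ) x
  have h4 := h2.unique h3
  obtain ⟨v, hv⟩ := hsurj (f x)
  have := congrArg (fun L => L v) h4
  simp [hv, h1] at this

theorem image_ball_eq_of_bijective {E : Type*} [SeminormedAddCommGroup E] {f : E → E} {r : ℝ}
    (hf : Function.Bijective f) (h : ∀ x, r ≤ ‖x‖ → f x = x) : f '' ball 0 r = ball 0 r := by
  have hc : f '' (ball 0 r)ᶜ = (ball 0 r)ᶜ := by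
    rw [image_congr (g := id) (fun x hx => h x (by simpa using hx)), image_id]
  rw [image_compl_eq hf] at hc
  exact compl_injective hc

/-- A small Lipschitz perturbation of the identity, supported in a ball, preserves its volume. -/
theorem integral_det_one_add_fderiv_eq_volume {E : Type*} [NormedAddCommGroup E]
    [InnerProductSpace ℝ E] [FiniteDimensional ℝ E] [MeasurableSpace E] [BorelSpace E]
    {g : E → E} {g' : E → E →L[ℝ] E} {K : NNReal} {r : ℝ}
    (hg : LipschitzWith K g) (hK : K < 1) (h0 : ∀ x, r ≤ ‖x‖ → g x = 0)
    (hg' : ∀ x ∈ ball (0 : E) r, HasFDerivAt g (g' x) x) :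
    IntegrableOn (fun x => (1 + g' x).det) (ball 0 r) ∧
      ∫ x in ball 0 r, (1 + g' x).det = volume.real (ball (0 : E) r) := by
  let f : E → E := fun x => x + g x
  have happrox : ApproximatesLinearOn f ((ContinuousLinearEquiv.refl ℝ E : E ≃L[ℝ] E) : E →L[ℝ] E)
      univ K := by
    intro x _ y _
    have := hg.dist_le_mul x y
    rw [dist_eq_norm, dist_eq_norm] at this
    have hsub : f x - f y - (x - y) = g x - g y := by simp only [f]; abel
    simpa [hsub] using this
  have hbij : Function.Bijective f := by
    refine (happrox.toHomeomorph f ?_).bijective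
    rcases subsingleton_or_nontrivial E with h | h
    · exact Or.inl h
    · right
      simpa using hK
  have himg : f '' ball 0 r = ball 0 r :=
    image_ball_eq_of_bijective hbij fun x hx => by simp [f, h0 x hx]
  have hf' : ∀ x ∈ ball (0 : E) r, HasFDerivWithinAt f (1 + g' x) (ball 0 r) x := fun x hx =>
    ((hasFDerivAt_id x).add (hg' x hx)).hasFDerivWithinAt
  have hdet : EqOn (fun x => |(1 + g' x).det| • (1 : ℝ)) (fun x => (1 + g' x).det) (ball 0 r) := by
    intro x hx
    have hn : ‖g' x‖ < 1 :=
      lt_of_le_of_lt ((hg' x hx).le_of_lipschitz hg) (by exact_mod_cast hK)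
    simp [abs_of_pos (ContinuousLinearMap.det_one_add_pos _ hn)]
  have hint := integrableOn_image_iff_integrableOn_abs_det_fderiv_smul volume measurableSet_ball
    hf' hbij.1.injOn (fun _ => (1 : ℝ))
  have hval := integral_image_eq_integral_abs_det_fderiv_smul volume measurableSet_ball
    hf' hbij.1.injOn (fun _ => (1 : ℝ))
  rw [himg, integrableOn_congr_fun hdet measurableSet_ball] at hint
  rw [himg, setIntegral_congr_fun measurableSet_ball hdet] at hval
  refine ⟨hint.1 (integrableOn_const measure_ball_lt_top.ne), ?_⟩
  rw [← hval]
  simp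

/-- The unit sphere of a Euclidean space is not a smooth retract of the unit ball. -/
theorem not_exists_contDiff_sphere_retraction {E : Type*} [NormedAddCommGroup E]
    [InnerProductSpace ℝ E] [FiniteDimensional ℝ E] {f : E → E} (hf : ContDiff ℝ 1 f)
    (h1 : ∀ x, ‖f x‖ = 1) : ∃ x, ‖x‖ = 1 ∧ f x ≠ x := by
  by_contra! hid
  let _ : MeasurableSpace E := borel E
  have : BorelSpace E := ⟨rfl⟩
  obtain ⟨K, hK⟩ : ∃ K, LipschitzOnWith K (fun x => f x - x) (closedBall 0 1) :=
    (hf.sub contDiff_id).locallyLipschitz.locallyLipschitzOn.exists_lipschitzOnWith_of_compact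
      (isCompact_closedBall 0 1)
  let g : E → E := (ball 0 1).indicator fun x => f x - x
  have hg0 : ∀ x, 1 ≤ ‖x‖ → g x = 0 := fun x hx => indicator_of_notMem (by simpa using hx) _
  have hgeq : ∀ x, ‖x‖ ≤ 1 → g x = f x - x := by
    intro x hx
    rcases hx.lt_or_eq with h | h
    · exact indicator_of_mem (by simpa using h) _
    · rw [hg0 x h.ge, hid x h, sub_self]
  have hgL : LipschitzWith K g := by
    refine LipschitzOnWith.extend_zero_closedBall (r := 1) (fun x hx y hy => ?_) hg0
    rw [hgeq x (by simpa using hx), hgeq y (by simpa using hy)]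
    exact hK hx hy
  have hfd : ∀ x, HasFDerivAt f (fderiv ℝ f x) x := fun x =>
    (hf.differentiable (by simp) x).hasFDerivAt
  have hg' : ∀ x ∈ ball (0 : E) 1, HasFDerivAt g (fderiv ℝ f x - 1) x := by
    intro x hx
    refine ((hfd x).sub (hasFDerivAt_id x)).congr_of_eventuallyEq ?_
    filter_upwards [isOpen_ball.mem_nhds hx] with y hy
    exact indicator_of_mem hy _
  let δ : ℝ := 1 / (K + 1)
  have hδ : 0 < δ := by positivity
  obtain ⟨s, hs, hcard⟩ := (Icc_infinite hδ).exists_subset_card_eq (Module.finrank ℝ E + 1)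
  have hvol : ∀ t ∈ s, IntegrableOn (fun x => (1 + t • (fderiv ℝ f x - 1)).det) (ball 0 1) ∧
      ∫ x in ball 0 1, (1 + t • (fderiv ℝ f x - 1)).det = volume.real (ball (0 : E) 1) := by
    intro t ht
    obtain ⟨ht0, ht1⟩ := hs ht
    lift t to NNReal using ht0
    refine integral_det_one_add_fderiv_eq_volume (g := fun x => (t : ℝ) • g x) (K := t * K)
      ?_ ?_ ?_ ?_
    · simpa [Function.comp_def] using (lipschitzWith_smul (t : ℝ) (β := E)).comp hgL
    · rw [← NNReal.coe_lt_coe]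
      push_cast
      calc (t : ℝ) * K ≤ δ * K := by gcongr
        _ < 1 := by
          rw [div_mul_eq_mul_div, one_mul, div_lt_one (by positivity)]
          linarith
    · intro x hx
      simp [hg0 x hx]
    · intro x hx
      exact (hg' x hx).const_smul (t : ℝ)
  have hzero : ∀ x, ∑ t ∈ s, (1 + t • (fderiv ℝ f x - 1)).det * (Lagrange.basis s id t).eval 1
      = 0 := by
    intro x
    rw [← ContinuousLinearMap.det_one_add_eq_sum_lagrange _ (by omega), add_sub_cancel]
    exact det_fderiv_eq_zero_of_norm_eq_one (hfd x) h1
  have hsum : ∑ t ∈ s, (Lagrange.basis s id t).eval (1 : ℝ) = 1 := by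
    rw [← Polynomial.eval_finsetSum, Lagrange.sum_basis Function.injective_id.injOn
      (Finset.card_pos.1 (by omega)), Polynomial.eval_one]
  have hI : ∫ x in ball (0 : E) 1,
      ∑ t ∈ s, (1 + t • (fderiv ℝ f x - 1)).det * (Lagrange.basis s id t).eval 1
      = volume.real (ball (0 : E) 1) := by
    rw [integral_finsetSum _ fun t ht => (hvol t ht).1.mul_const _]
    rw [Finset.sum_congr rfl fun t ht => by rw [integral_mul_const, (hvol t ht).2],
      ← Finset.mul_sum, hsum, mul_one]
  simp only [hzero, integral_zero] at hI
  exact (ENNReal.toReal_pos (measure_ball_pos volume (0 : E) one_pos).ne'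
    measure_ball_lt_top.ne).ne hI

/-- The unit sphere of a Euclidean space is not contractible. -/
theorem not_contractibleSpace_sphere (E : Type*) [NormedAddCommGroup E]
    [InnerProductSpace ℝ E] [FiniteDimensional ℝ E] :
    ¬ ContractibleSpace (sphere (0 : E) 1) := by
  intro hE
  obtain ⟨y₀, ⟨H⟩⟩ := id_nullhomotopic (sphere (0 : E) 1)
  classical
  let N : E → sphere (0 : E) 1 := fun x =>
    if hx : x = 0 then y₀ else ⟨‖x‖⁻¹ • x, by simp [norm_smul, hx]⟩
  have hN : ∀ x, x ≠ 0 → (N x : E) = ‖x‖⁻¹ • x := fun x hx => by simp [N, hx]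
  have hNc : ContinuousOn N {0}ᶜ := by
    rw [Topology.IsInducing.subtypeVal.continuousOn_iff]
    refine ContinuousOn.congr (f := fun x : E => ‖x‖⁻¹ • x) ?_ fun x hx => hN x hx
    exact (continuousOn_id.norm.inv₀ fun x hx => norm_ne_zero_iff.2 hx).smul continuousOn_id
  let τ : E → unitInterval := fun x => projIcc 0 1 zero_le_one (3 - 4 * ‖x‖)
  have hτ : Continuous τ := continuous_projIcc.comp (by fun_prop)
  let F : E → E := fun x => H (τ x, N x)
  have hF1 : ∀ x, ‖F x‖ = 1 := fun x => by simp [F]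
  have hFin : ∀ x, ‖x‖ ≤ 1 / 2 → F x = y₀ := by
    intro x hx
    have : τ x = 1 := projIcc_of_right_le _ (by linarith)
    simp [F, this]
  have hFout : ∀ x, 3 / 4 ≤ ‖x‖ → F x = ‖x‖⁻¹ • x := by
    intro x hx
    have : τ x = 0 := projIcc_of_le_left _ (by linarith)
    have hx0 : x ≠ 0 := by rintro rfl; norm_num at hx
    simp [F, this, hN x hx0]
  have hFc : Continuous F := by
    rw [continuous_iff_continuousAt]
    intro x
    by_cases hx : x = 0
    · subst hx
      refine (continuousAt_const (y := (y₀ : E))).congr ?_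
      filter_upwards [ball_mem_nhds (0 : E) (ε := 1 / 2) (by norm_num)] with y hy
      exact (hFin y (by simpa using (mem_ball.1 hy).le)).symm
    · have hNx : ContinuousAt N x := hNc.continuousAt (isOpen_compl_singleton.mem_nhds hx)
      exact (continuous_subtype_val.comp H.continuous).continuousAt.comp
        (hτ.continuousAt.prodMk hNx)
  have hU : {x : E | 3 / 4 < ‖x‖} ∈ nhdsSet {x : E | 1 ≤ ‖x‖} :=
    (isOpen_lt continuous_const continuous_norm).mem_nhdsSet.2 fun x hx =>
      lt_of_lt_of_le (by norm_num) (show (1 : ℝ) ≤ ‖x‖ from hx)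
  have hsm : ContDiffOn ℝ (1 : ℕ∞) F {x : E | 3 / 4 < ‖x‖} := by
    refine ContDiffOn.congr (f := fun x : E => ‖x‖⁻¹ • x) ?_ fun x hx =>
      hFout x (le_of_lt hx)
    have h0 : ∀ x ∈ {x : E | 3 / 4 < ‖x‖}, x ≠ 0 := by
      rintro x hx rfl
      norm_num at hx
    exact ((contDiffOn_id.norm ℝ h0).inv fun x hx => norm_ne_zero_iff.2 (h0 x hx)).smul
      contDiffOn_id
  obtain ⟨g, hg, hgF, hgS, -⟩ := hFc.exists_contDiff_approx_and_eqOn 1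
    (ε := fun _ => 1 / 2) continuous_const (fun _ => by norm_num)
    (isClosed_le continuous_const continuous_norm) hU hsm
  have hg0 : ∀ x, g x ≠ 0 := by
    intro x hx
    have := hgF x
    rw [hx, dist_zero_left, hF1] at this
    norm_num at this
  obtain ⟨x, hx1, hx⟩ := not_exists_contDiff_sphere_retraction
    (f := fun x => ‖g x‖⁻¹ • g x)
    (((hg.norm ℝ hg0).inv fun x => norm_ne_zero_iff.2 (hg0 x)).smul hg)
    (fun x => by simp [norm_smul, hg0 x])
  apply hx
  have : g x = x := by
    rw [hgS hx1.ge, hFout x (by rw [hx1]; norm_num), hx1, inv_one, one_smul]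
  simp [this, hx1]

theorem ContinuousMap.HomotopyEquiv.pathConnectedSpace {X Y : Type*} [TopologicalSpace X]
    [TopologicalSpace Y] [PathConnectedSpace Y] (e : ContinuousMap.HomotopyEquiv X Y) :
    PathConnectedSpace X := by
  obtain ⟨H⟩ := e.left_inv
  refine ⟨⟨e.invFun (Classical.arbitrary Y)⟩, fun x y => ?_⟩
  have key : ∀ z, Joined (e.invFun (e.toFun z)) z := fun z => ⟨H.evalAt z⟩
  exact (key x).symm.trans (((PathConnectedSpace.joined (e.toFun x) (e.toFun y)).map
    e.invFun.continuous).trans (key y))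

/-- A point of the cube lies in the cubical complex of a CNF formula iff it satisfies every
non-tautological clause by an exact literal. -/
theorem mem_inducedCubicalComplex_cnfDisc {V : Type*} {Φ : Finset (Finset (V × Bool))}
    {p : V → ℝ} :
    p ∈ inducedCubicalComplex (cnfDisc Φ) ↔ (∀ i, 0 ≤ p i ∧ p i ≤ 1) ∧
      ∀ C ∈ Φ, (∃ i, (i, true) ∈ C ∧ (i, false) ∈ C) ∨ ∃ l ∈ C, p l.1 = l.2.toNat := by
  classical
  refine and_congr_right fun hp => ⟨fun h C hC => ?_, fun h v hv C hC => ?_⟩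
  · let w : V → Bool := fun i =>
      if p i = 0 then false else if p i = 1 then true else decide ((i, true) ∉ C)
    obtain ⟨⟨i, b⟩, hl, hb⟩ := h w (fun i => by
      constructor <;> intro hi <;> simp [w, hi]) C hC
    by_cases h0 : p i = 0
    · refine Or.inr ⟨_, hl, ?_⟩
      simp only [w, h0, if_true] at hb
      simp [← hb, h0]
    by_cases h1 : p i = 1
    · refine Or.inr ⟨_, hl, ?_⟩
      simp only [w, h1, one_ne_zero, if_true, if_false] at hb
      simp [← hb, h1]
    simp only [w, h0, h1, if_false] at hb
    cases b <;> simp at hb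
    · exact Or.inl ⟨i, hb, hl⟩
    · exact absurd hl hb
  · rcases h C hC with ⟨i, ht, hf⟩ | ⟨⟨i, b⟩, hl, hb⟩
    · cases hvi : v i
      · exact ⟨_, hf, hvi⟩
      · exact ⟨_, ht, hvi⟩
    · refine ⟨_, hl, ?_⟩
      cases b
      · exact (hv i).1 (by simpa using hb)
      · exact (hv i).2 (by simpa using hb)

/-- Move `x` towards the endpoint of the unit interval encoded by `b`, until its distance to that
endpoint is at most `c`. -/
noncomputable def pushToEndpoint (b : Bool) (c x : ℝ) : ℝ :=
  bif b then max x (1 - c) else min x c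

theorem pushToEndpoint_one {b : Bool} {x : ℝ} (h0 : 0 ≤ x) (h1 : x ≤ 1) :
    pushToEndpoint b 1 x = x := by
  cases b <;> simp [pushToEndpoint, h0, h1]

theorem pushToEndpoint_zero {b : Bool} {x : ℝ} (h0 : 0 ≤ x) (h1 : x ≤ 1) :
    pushToEndpoint b 0 x = b.toNat := by
  cases b <;> simp [pushToEndpoint, h0, h1]

theorem pushToEndpoint_endpoint {b : Bool} {c : ℝ} (h0 : 0 ≤ c) :
    pushToEndpoint b c b.toNat = b.toNat := by
  cases b <;> simp [pushToEndpoint, h0]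

theorem pushToEndpoint_mem_Icc {b : Bool} {c x : ℝ} (hc0 : 0 ≤ c) (hc1 : c ≤ 1)
    (h0 : 0 ≤ x) (h1 : x ≤ 1) : 0 ≤ pushToEndpoint b c x ∧ pushToEndpoint b c x ≤ 1 := by
  cases b <;> simp [pushToEndpoint, *]

theorem continuous_pushToEndpoint (b : Bool) :
    Continuous fun y : ℝ × ℝ => pushToEndpoint b y.1 y.2 := by
  cases b <;> simp only [pushToEndpoint, cond_true, cond_false] <;> fun_prop

/-- A set of points of the unit cube, seen from the vertex `v`, forces coordinate `j` to be opposite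
to `v j` as soon as coordinate `i` differs from `v i`. -/
def Forces {V : Type*} (N : Set (V → ℝ)) (v : V → Bool) (i j : V) : Prop :=
  ∀ q ∈ N, q i = (v i).toNat ∨ q j = (!v j).toNat

theorem Forces.trans {V : Type*} {N : Set (V → ℝ)} {v : V → Bool} {i j k : V}
    (hij : Forces N v i j) (hjk : Forces N v j k) : Forces N v i k := by
  intro q hq
  refine (hij q hq).imp_right fun h => (hjk q hq).resolve_left ?_
  rw [h]
  cases v j <;> simp

theorem Forces.eq_of_self {V : Type*} {N : Set (V → ℝ)} {v : V → Bool} {i : V}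
    (hN : IsPreconnected N) (hv : (fun k => ((v k).toNat : ℝ)) ∈ N) (hi : Forces N v i i) :
    ∀ q ∈ N, q i = (v i).toNat := by
  intro q hq
  refine (hi q hq).resolve_right fun h => ?_
  have hc := (hN.image (fun q : V → ℝ => q i) (continuous_apply i).continuousOn).ordConnected
  have hsub := hc.uIcc_subset (mem_image_of_mem _ hv) (mem_image_of_mem _ hq)
  have hhalf : (1 / 2 : ℝ) ∈ uIcc ((v i).toNat : ℝ) (q i) := by
    rw [h, mem_uIcc]
    cases v i <;> norm_num
  obtain ⟨r, hr, hri⟩ := hsub hhalf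
  have := hi r hr
  simp only at hri
  rw [hri] at this
  revert this
  cases v i <;> norm_num

/-- The forcing relation between non-constant coordinates of a connected set can be ranked. -/
theorem exists_rank_of_forces {V : Type*} [Fintype V] {N : Set (V → ℝ)} {v : V → Bool}
    (hN : IsPreconnected N) (hv : (fun k => ((v k).toNat : ℝ)) ∈ N) :
    ∃ ρ : V → ℕ, (∀ i, ρ i ≤ Fintype.card V) ∧
      ∀ i j, Forces N v i j → (∃ q ∈ N, q i ≠ (v i).toNat) → ρ i < ρ j := by
  classical
  refine ⟨fun j => (Finset.univ.filter fun i =>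
    Forces N v i j ∧ ∃ q ∈ N, q i ≠ (v i).toNat).card, fun i => Finset.card_le_univ _,
    fun i j hij hi => Finset.card_lt_card ?_⟩
  rw [Finset.ssubset_iff_of_subset]
  · refine ⟨i, by simpa using ⟨hij, hi⟩, fun h => ?_⟩
    obtain ⟨q, hq, hqi⟩ := hi
    exact hqi (Forces.eq_of_self hN hv (Finset.mem_filter.1 h).2.1 q hq)
  · intro k hk
    simp only [Finset.mem_filter, Finset.mem_univ, true_and] at hk ⊢
    exact ⟨hk.1.trans hij, hk.2⟩

/-- A two-literal clause containing one literal true at `v` and one false at `v` forces. -/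
theorem twoSat_clause_forces {V : Type*} {Φ : Finset (Finset (V × Bool))} {v : V → Bool}
    {C : Finset (V × Bool)} (hC : C ∈ Φ) (hcard : C.card ≤ 2)
    (htaut : ¬ ∃ i, (i, true) ∈ C ∧ (i, false) ∈ C) {i j : V} (hi : (i, v i) ∈ C)
    (hj : (j, !v j) ∈ C) : Forces (inducedCubicalComplex (cnfDisc Φ)) v i j := by
  classical
  intro q hq
  obtain ⟨l, hl, hql⟩ := ((mem_inducedCubicalComplex_cnfDisc.1 hq).2 C hC).resolve_left htaut
  have hne : (i, v i) ≠ (j, !v j) := by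
    rintro h
    obtain ⟨rfl, h⟩ := Prod.mk.inj h
    simp at h
  have hCeq : {(i, v i), (j, !v j)} = C :=
    Finset.eq_of_subset_of_card_le (by simp [Finset.insert_subset_iff, hi, hj])
      (by rwa [Finset.card_pair hne])
  rw [← hCeq, Finset.mem_insert, Finset.mem_singleton] at hl
  rcases hl with rfl | rfl
  · exact Or.inl hql
  · exact Or.inr hql

/-- A nonempty connected solution complex of a 2-SAT formula is contractible. -/
theorem contractibleSpace_twoSat {V : Type*} [Fintype V] {Φ : Finset (Finset (V × Bool))}
    (h2 : ∀ C ∈ Φ, C.card ≤ 2) [ConnectedSpace (inducedCubicalComplex (cnfDisc Φ))] :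
    ContractibleSpace (inducedCubicalComplex (cnfDisc Φ)) := by
  classical
  set N := inducedCubicalComplex (cnfDisc Φ)
  have hN : IsPreconnected N := isPreconnected_iff_preconnectedSpace.2 inferInstance
  obtain ⟨p₀, hp₀⟩ : Nonempty N := inferInstance
  let v : V → Bool := fun i => decide (p₀ i = 1)
  have hvΦ : v ∈ cnfDisc Φ := hp₀.2 v fun i => by
    constructor <;> intro hi <;> simp [v, hi]
  have hv : (fun k => ((v k).toNat : ℝ)) ∈ N := by
    refine mem_inducedCubicalComplex_cnfDisc.2 ⟨fun i => ?_, fun C hC => Or.inr ?_⟩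
    · cases v i <;> simp
    · obtain ⟨l, hl, h⟩ := hvΦ C hC
      exact ⟨l, hl, by simp [h]⟩
  obtain ⟨ρ, hρle, hρ⟩ := exists_rank_of_forces hN hv
  let c : V → ℝ → ℝ := fun i t => max 0 (min 1 (ρ i + 1 - (Fintype.card V + 1) * t))
  have hc0 : ∀ i t, 0 ≤ c i t := fun i t => le_max_left _ _
  have hc1 : ∀ i t, c i t ≤ 1 := fun i t => max_le zero_le_one (min_le_left _ _)
  have hstep : ∀ i j t, ρ i < ρ j → c j t = 1 ∨ c i t = 0 := by
    intro i j t hij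
    have hij' : (ρ i : ℝ) + 1 ≤ ρ j := by exact_mod_cast hij
    rcases le_total ((Fintype.card V + 1) * t) (ρ j) with h | h
    · left
      simp only [c]
      rw [min_eq_left (by linarith), max_eq_right zero_le_one]
    · right
      simp only [c]
      exact max_eq_left ((min_le_right _ _).trans (by linarith))
  let H : ℝ → (V → ℝ) → V → ℝ := fun t p i => pushToEndpoint (v i) (c i t) (p i)
  have hHN : ∀ t, ∀ p ∈ N, H t p ∈ N := by
    intro t p hp
    obtain ⟨hp01, hpC⟩ := mem_inducedCubicalComplex_cnfDisc.1 hp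
    refine mem_inducedCubicalComplex_cnfDisc.2 ⟨fun i =>
      pushToEndpoint_mem_Icc (hc0 i t) (hc1 i t) (hp01 i).1 (hp01 i).2, fun C hC => ?_⟩
    refine or_iff_not_imp_left.2 fun htaut => ?_
    have hstay : ∀ i, p i = (v i).toNat → H t p i = (v i).toNat := fun i hi => by
      simp only [H, hi, pushToEndpoint_endpoint (hc0 i t)]
    obtain ⟨⟨i, b⟩, hi, hvi⟩ := hvΦ C hC
    obtain rfl : v i = b := hvi
    by_cases hpi : p i = (v i).toNat
    · exact ⟨_, hi, hstay i hpi⟩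
    obtain ⟨⟨j, b⟩, hj, hpj⟩ := (hpC C hC).resolve_left htaut
    rcases Bool.eq_or_eq_not b (v j) with rfl | rfl
    · exact ⟨_, hj, hstay j hpj⟩
    rcases hstep i j t (hρ i j (twoSat_clause_forces hC (h2 C hC) htaut hi hj) ⟨p, hp, hpi⟩)
      with h | h
    · refine ⟨_, hj, ?_⟩
      simp only [H, h, pushToEndpoint_one (hp01 j).1 (hp01 j).2]
      exact hpj
    · refine ⟨_, hi, ?_⟩
      simp only [H, h, pushToEndpoint_zero (hp01 i).1 (hp01 i).2]
  have hHc : Continuous fun y : ℝ × (V → ℝ) => H y.1 y.2 := by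
    refine continuous_pi fun i => (continuous_pushToEndpoint (v i)).comp
      (f := fun y : ℝ × (V → ℝ) => (c i y.1, y.2 i)) ?_
    fun_prop
  rw [contractible_iff_id_nullhomotopic]
  refine ⟨⟨_, hv⟩, ⟨⟨⟨fun y => ⟨H y.1 y.2, hHN _ _ y.2.2⟩, ?_⟩, ?_, ?_⟩⟩⟩
  · exact (hHc.comp (f := fun y : unitInterval × N => ((y.1 : ℝ), (y.2 : V → ℝ)))
      (by fun_prop)).subtype_mk _
  · intro p
    ext i
    have : c i 0 = 1 := by simp [c]
    simp [H, this, pushToEndpoint_one (p.2.1 i).1 (p.2.1 i).2]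
  · intro p
    ext i
    have : c i 1 = 0 := by simp [c, hρle i]
    simp [H, this, pushToEndpoint_zero (p.2.1 i).1 (p.2.1 i).2]

/-- The solution space of a 2-SAT formula is never homotopy equivalent to a sphere
of dimension `p ≥ 1`. -/
theorem twoSat_not_homotopyEquiv_sphere
    (d : ℕ) (Φ : Finset (Finset (Fin d × Bool)))
    (h2 : ∀ C ∈ Φ, C.card ≤ 2) (p : ℕ) (hp : 1 ≤ p) :
    ¬ Nonempty (ContinuousMap.HomotopyEquiv
      (inducedCubicalComplex (cnfDisc Φ))
      (Metric.sphere (0 : EuclideanSpace ℝ (Fin (p + 1))) 1)) := by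
  rintro ⟨e⟩
  have hrank : 1 < Module.rank ℝ (EuclideanSpace ℝ (Fin (p + 1))) := by
    rw [← Module.finrank_eq_rank, finrank_euclideanSpace_fin]
    exact_mod_cast Nat.lt_add_of_pos_left hp
  have : PathConnectedSpace (sphere (0 : EuclideanSpace ℝ (Fin (p + 1))) 1) :=
    isPathConnected_iff_pathConnectedSpace.1 (isPathConnected_sphere hrank 0 zero_le_one)
  have := e.pathConnectedSpace
  have := contractibleSpace_twoSat h2
  exact not_contractibleSpace_sphere _ e.symm.contractibleSpace
end
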